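/- arXiv:0906.1957 — 3 statements merged into one kernel-verified Lean document; each statement's English description precedes it below -/
import Mathlib

section
/- As n → ∞, ∑_{k=1}^{n} C(n,k)·(−1)^k·e^{−1/k} = −cos(2√(log n) − π/4) / (√π·(log n)^{1/4}) + o((log n)^{−1/4}). -/
open Filter Asymptotics
open scoped Topology

lemma fres_tail (b : ℂ) (hb : 0 ≤ b.re) (hb1 : 1 ≤ ‖b‖) (R M : ℝ) (hR : 0 < R) (hM : R ≤ M) :
    ‖∫ y in R..M, Complex.exp (-b * (y:ℂ) ^ 2)‖ ≤ 1 / R := by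
  have hM0 : 0 < M := lt_of_lt_of_le hR hM
  have hb0 : b ≠ 0 := by
    rintro rfl
    norm_num at hb1
  have hpos : ∀ y ∈ Set.uIcc R M, 0 < y := by
    intro y hy
    rw [Set.uIcc_of_le hM] at hy
    exact lt_of_lt_of_le hR hy.1
  have hn : ∀ y : ℝ, ‖Complex.exp (-b * (y:ℂ) ^ 2)‖ ≤ 1 := by
    intro y
    rw [Complex.norm_exp]
    apply Real.exp_le_one_iff.mpr
    have : (-b * (y:ℂ)^2).re = -(b.re * y^2) := by
      rw [← Complex.ofReal_pow, Complex.re_mul_ofReal]; simp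
    rw [this]
    have := mul_nonneg hb (sq_nonneg y)
    linarith
  have hd : ∀ y ∈ Set.uIcc R M, HasDerivAt
      (fun y : ℝ => Complex.exp (-b * (y:ℂ) ^ 2) / (-2 * b * (y:ℂ)))
      (Complex.exp (-b * (y:ℂ) ^ 2) + Complex.exp (-b * (y:ℂ) ^ 2) / (2 * b * (y:ℂ)^2)) y := by
    intro y hy
    have hy0 : (y:ℂ) ≠ 0 := by exact_mod_cast (hpos y hy).ne'
    have h1 : HasDerivAt (fun y : ℂ => Complex.exp (-b * y ^ 2) / (-2 * b * y))
      (Complex.exp (-b * (y:ℂ) ^ 2) + Complex.exp (-b * (y:ℂ) ^ 2) / (2 * b * (y:ℂ)^2)) (y:ℂ) := by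
      have h2 := (((hasDerivAt_pow 2 (y:ℂ)).const_mul (-b)).cexp).div
        ((hasDerivAt_id (y:ℂ)).const_mul (-2 * b)) (by simp [hb0, hy0])
      refine h2.congr_deriv ?_
      simp only [id]
      field_simp
      push_cast
      ring
    exact h1.comp_ofReal
  have hc1 : ContinuousOn (fun y : ℝ => Complex.exp (-b * (y:ℂ) ^ 2)) (Set.uIcc R M) := by fun_prop
  have hc2 : ContinuousOn (fun y : ℝ => Complex.exp (-b * (y:ℂ) ^ 2) / (2 * b * (y:ℂ)^2)) (Set.uIcc R M) := by
    apply ContinuousOn.div (by fun_prop) (by fun_prop)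
    intro y hy
    have hy0 : (y:ℂ) ≠ 0 := by exact_mod_cast (hpos y hy).ne'
    simp [hb0, hy0]
  have hF := intervalIntegral.integral_eq_sub_of_hasDerivAt hd (hc1.add hc2).intervalIntegrable
  rw [intervalIntegral.integral_add hc1.intervalIntegrable hc2.intervalIntegrable] at hF
  have hB : ∀ y : ℝ, 0 < y → ‖Complex.exp (-b * (y:ℂ) ^ 2) / (-2 * b * (y:ℂ))‖ ≤ 1 / (2 * y) := by
    intro y hy
    rw [norm_div]
    apply div_le_div₀ (by norm_num) (hn y) (by positivity)
    simp only [norm_mul, norm_neg, Complex.norm_real, Real.norm_eq_abs, abs_of_pos hy]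
    simp only [Complex.norm_ofNat]
    nlinarith
  have hI : ‖∫ y in R..M, Complex.exp (-b * (y:ℂ) ^ 2) / (2 * b * (y:ℂ)^2)‖ ≤ ∫ y in R..M, (1/2) * (y^2)⁻¹ := by
    apply intervalIntegral.norm_integral_le_of_norm_le hM
    · refine Eventually.of_forall fun y hy => ?_
      have hy : 0 < y := lt_trans hR hy.1
      rw [norm_div, show (1/2) * (y^2)⁻¹ = 1 / (2 * y^2) by field_simp]
      apply div_le_div₀ (by norm_num) (hn y) (by positivity)
      simp only [norm_mul, norm_pow, Complex.norm_real, Real.norm_eq_abs, abs_of_pos hy]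
      simp only [Complex.norm_ofNat]
      nlinarith [sq_nonneg y]
    · apply ContinuousOn.intervalIntegrable
      apply ContinuousOn.mul (by fun_prop)
      apply ContinuousOn.inv₀ (by fun_prop)
      intro y hy
      have := hpos y hy
      positivity
  have hI2 : ∫ y in R..M, (1/2) * (y^2)⁻¹ = 1/(2*R) - 1/(2*M) := by
    have hd2 : ∀ y ∈ Set.uIcc R M, HasDerivAt (fun y : ℝ => -(1/2) * y⁻¹) ((1/2) * (y^2)⁻¹) y := by
      intro y hy
      have := (hasDerivAt_inv (hpos y hy).ne').const_mul (-(1/2))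
      refine this.congr_deriv ?_
      ring
    rw [intervalIntegral.integral_eq_sub_of_hasDerivAt hd2]
    · field_simp
      ring
    · apply ContinuousOn.intervalIntegrable
      apply ContinuousOn.mul (by fun_prop)
      apply ContinuousOn.inv₀ (by fun_prop)
      intro y hy
      have := hpos y hy
      positivity
  rw [eq_sub_of_add_eq hF]
  refine (norm_sub_le _ _).trans ?_
  refine (add_le_add (norm_sub_le _ _) le_rfl).trans ?_
  have e1 := hB M hM0
  have e2 := hB R hR
  have e3 : 1 / R = 1/(2*R) + 1/(2*R) := by field_simp; norm_num
  linarith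

lemma fres_aux (ε : ℝ) (hε : 0 < ε) (R : ℝ) (hR : 0 < R) :
    ‖((Real.pi : ℂ) / ((ε:ℂ) + Complex.I)) ^ (1/2 : ℂ) / 2 -
      ∫ y in (0:ℝ)..R, Complex.exp (-((ε:ℂ) + Complex.I) * (y:ℂ) ^ 2)‖ ≤ 1 / R := by
  set b : ℂ := (ε:ℂ) + Complex.I with hbdef
  have hre : 0 < b.re := by simp [hbdef, hε]
  have him : b.im = 1 := by simp [hbdef]
  have hb1 : 1 ≤ ‖b‖ := by
    have := Complex.abs_im_le_norm b
    rw [him] at this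
    simpa using this
  have hI := integral_gaussian_complex_Ioi hre
  have hint : MeasureTheory.IntegrableOn (fun y : ℝ => Complex.exp (-b * (y:ℂ) ^ 2)) (Set.Ioi 0) :=
    (integrable_cexp_neg_mul_sq hre).integrableOn
  have ht := MeasureTheory.intervalIntegral_tendsto_integral_Ioi (0:ℝ) hint tendsto_id
  rw [hI] at ht
  refine le_of_tendsto (ht.sub_const _).norm ?_
  filter_upwards [eventually_ge_atTop R] with M hM
  have hc : Continuous (fun y : ℝ => Complex.exp (-b * (y:ℂ) ^ 2)) := by fun_prop
  rw [id, intervalIntegral.integral_interval_sub_left (hc.intervalIntegrable _ _) (hc.intervalIntegrable _ _)]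
  exact fres_tail b hre.le hb1 R M hR hM

lemma fres_const : ((Real.pi : ℂ) / Complex.I) ^ (1/2 : ℂ) / 2 =
    ((Real.sqrt Real.pi / 2 : ℝ) : ℂ) * Complex.exp (-(Real.pi / 4 : ℝ) * Complex.I) := by
  have h : (Real.pi : ℂ) / Complex.I = (Real.pi : ℝ) * (-Complex.I) := by
    rw [div_eq_mul_inv, Complex.inv_I]
  have h0 : (-Complex.I) ≠ 0 := by simp
  have hp : (Real.pi : ℂ) ≠ 0 := by exact_mod_cast Real.pi_ne_zero
  rw [h, Complex.cpow_def_of_ne_zero (mul_ne_zero hp h0), Complex.log_ofReal_mul Real.pi_pos h0,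
    Complex.log_neg_I, add_mul, Complex.exp_add]
  have h1 : Complex.exp ((Real.log Real.pi : ℝ) * (1/2 : ℂ)) = ((Real.sqrt Real.pi : ℝ) : ℂ) := by
    rw [Real.sqrt_eq_rpow, Real.rpow_def_of_pos Real.pi_pos]
    push_cast
    rfl
  rw [h1]
  have h2 : -((Real.pi:ℂ) / 2) * Complex.I * (1/2 : ℂ) = -(Real.pi / 4 : ℝ) * Complex.I := by
    push_cast; ring
  rw [h2]
  push_cast
  ring

lemma fres (R : ℝ) (hR : 0 < R) :
    ‖(∫ y in (0:ℝ)..R, Complex.exp (-Complex.I * (y:ℂ) ^ 2)) -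
      ((Real.sqrt Real.pi / 2 : ℝ) : ℂ) * Complex.exp (-(Real.pi / 4 : ℝ) * Complex.I)‖ ≤ 1 / R := by
  rw [norm_sub_rev, ← fres_const]
  have hc : Continuous (fun ε : ℝ => ∫ y in (0:ℝ)..R, Complex.exp (-((ε:ℂ) + Complex.I) * (y:ℂ) ^ 2)) := by
    apply intervalIntegral.continuous_parametric_intervalIntegral_of_continuous' 
    simp only [Function.uncurry_def]
    fun_prop
  have h1 : ContinuousAt (fun ε : ℝ => ((Real.pi : ℂ) / ((ε:ℂ) + Complex.I)) ^ (1/2 : ℂ) / 2 -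
      ∫ y in (0:ℝ)..R, Complex.exp (-((ε:ℂ) + Complex.I) * (y:ℂ) ^ 2)) 0 := by
    refine ContinuousAt.sub (ContinuousAt.div_const (ContinuousAt.cpow ?_ continuousAt_const ?_) _) hc.continuousAt
    · refine ContinuousAt.div (by fun_prop) (by fun_prop) (by simp)
    · right
      simp [Real.pi_ne_zero]
  have h2 := (h1.tendsto.mono_left (nhdsWithin_le_nhds (s := Set.Ioi 0))).norm
  simp only [Complex.ofReal_zero, zero_add] at h2
  refine le_of_tendsto h2 ?_
  filter_upwards [self_mem_nhdsWithin] with ε hε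
  exact fres_aux ε hε R hR


/-- `besF t = J_0(2 √t)`. -/
noncomputable def besF (t : ℝ) : ℝ :=
  (2 / Real.pi) * ∫ θ in (0:ℝ)..(Real.pi / 2), Real.cos (2 * Real.sqrt t * Real.cos θ)

lemma besF_continuous : Continuous besF := by
  unfold besF
  apply Continuous.mul continuous_const
  apply intervalIntegral.continuous_parametric_intervalIntegral_of_continuous' 
  simp only [Function.uncurry_def]
  fun_prop

lemma besF_abs_le (t : ℝ) : |besF t| ≤ 1 := by
  unfold besF
  have h : ‖∫ θ in (0:ℝ)..(Real.pi / 2), Real.cos (2 * Real.sqrt t * Real.cos θ)‖ ≤ 1 * |Real.pi / 2 - 0| :=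
    intervalIntegral.norm_integral_le_of_norm_le_const fun θ _ => Real.abs_cos_le_one _
  have hp := Real.pi_pos
  rw [abs_mul, abs_of_pos (by positivity : 0 < 2 / Real.pi)]
  rw [sub_zero, one_mul, abs_of_pos (by positivity : 0 < Real.pi / 2), Real.norm_eq_abs] at h
  calc _ ≤ (2 / Real.pi) * (Real.pi / 2) := by gcongr
    _ = 1 := by field_simp

lemma wallis_prod (m : ℕ) : (4:ℝ)^m / ((2*m).factorial : ℝ) *
    ∏ i ∈ Finset.range m, (2 * (i : ℝ) + 1) / (2 * i + 2) = 1 / ((m.factorial : ℝ))^2 := by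
  induction m with
  | zero => simp
  | succ m ih =>
    rw [Finset.prod_range_succ, pow_succ, show 2 * (m+1) = (2*m+1)+1 by ring, Nat.factorial_succ,
      Nat.factorial_succ, Nat.factorial_succ]
    have h1 : ((2*m).factorial : ℝ) ≠ 0 := by positivity
    have h2 : (m.factorial : ℝ) ≠ 0 := by positivity
    have h3 : (m:ℝ) + 1 ≠ 0 := by positivity
    have h4 : 2 * (m:ℝ) + 1 ≠ 0 := by positivity
    have h5 : 2 * (m:ℝ) + 2 ≠ 0 := by positivity
    have h6 : 2 * (m:ℝ) + 1 + 1 ≠ 0 := by positivity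
    push_cast
    have : (4:ℝ) ^ m * 4 / ((2 * (m:ℝ) + 1 + 1) * ((2 * m + 1) * ((2*m).factorial : ℝ))) *
        ((∏ i ∈ Finset.range m, (2 * (i : ℝ) + 1) / (2 * i + 2)) * ((2 * m + 1) / (2 * m + 2)))
        = ((4:ℝ)^m / ((2*m).factorial : ℝ) *
    ∏ i ∈ Finset.range m, (2 * (i : ℝ) + 1) / (2 * i + 2)) * (1 / (m+1)^2) := by
      field_simp
      ring
    rw [this, ih]
    field_simp

lemma besF_hasSum (t : ℝ) (ht : 0 ≤ t) :
    HasSum (fun m : ℕ => (-1:ℝ)^m * t^m / ((m.factorial : ℝ))^2) (besF t) := by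
  have hp := Real.pi_pos
  have hy : ∀ (m : ℕ) (c : ℝ), (2 * Real.sqrt t * c)^(2*m) = 4^m * t^m * c^(2*m) := by
    intro m c
    have : (2 * Real.sqrt t * c)^2 = 4 * t * c^2 := by
      rw [mul_pow, mul_pow, Real.sq_sqrt ht]; norm_num
    rw [pow_mul, this, mul_pow, mul_pow, ← pow_mul]
  have key : HasSum (fun m : ℕ => ∫ θ in (0:ℝ)..(Real.pi / 2),
      (-1:ℝ)^m * (2 * Real.sqrt t * Real.cos θ)^(2*m) / ((2*m).factorial : ℝ))
      (∫ θ in (0:ℝ)..(Real.pi / 2), Real.cos (2 * Real.sqrt t * Real.cos θ)) := by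
    apply intervalIntegral.hasSum_integral_of_dominated_convergence
      (fun m _ => (2 * Real.sqrt t)^(2*m) / ((2*m).factorial : ℝ))
    · intro m
      apply Continuous.aestronglyMeasurable
      fun_prop
    · intro m
      refine Eventually.of_forall fun θ _ => ?_
      rw [norm_div, norm_mul, norm_pow, norm_neg, norm_one, one_pow, one_mul, norm_pow]
      rw [Real.norm_natCast, Real.norm_eq_abs, abs_mul, abs_of_nonneg (by positivity : 0 ≤ 2 * Real.sqrt t)]
      refine div_le_div_of_nonneg_right (pow_le_pow_left₀ (by positivity) ?_ _) (by positivity)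
      have := Real.abs_cos_le_one θ
      exact mul_le_of_le_one_right (by positivity) this
    · refine Eventually.of_forall fun θ _ => ?_
      have := Real.summable_pow_div_factorial (2 * Real.sqrt t)
      exact this.comp_injective (mul_right_injective₀ (two_ne_zero))
    · exact intervalIntegrable_const
    · refine Eventually.of_forall fun θ _ => ?_
      exact Real.hasSum_cos _
  have := key.mul_left (2 / Real.pi)
  unfold besF
  have he : (fun m : ℕ => (-1:ℝ)^m * t^m / ((m.factorial : ℝ))^2) = fun m : ℕ =>
      2 / Real.pi * ∫ θ in (0:ℝ)..(Real.pi / 2),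
      (-1:ℝ)^m * (2 * Real.sqrt t * Real.cos θ)^(2*m) / ((2*m).factorial : ℝ) := by
    funext m
    have h1 : ∀ θ : ℝ, (-1:ℝ)^m * (2 * Real.sqrt t * Real.cos θ)^(2*m) / ((2*m).factorial : ℝ) =
        ((-1:ℝ)^m * t^m * (4^m / ((2*m).factorial : ℝ))) * Real.cos θ ^ (2*m) := by
      intro θ
      rw [hy]; ring
    simp_rw [h1]
    rw [intervalIntegral.integral_const_mul, EulerSine.integral_cos_pow_eq, integral_sin_pow_even]
    have h2 := wallis_prod m
    have h3 : 2 / Real.pi * ((-1:ℝ)^m * t^m * (4^m / ((2*m).factorial : ℝ)) * (1 / 2 * (Real.pi *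
        ∏ i ∈ Finset.range m, (2 * (i : ℝ) + 1) / (2 * i + 2)))) = (-1:ℝ)^m * t^m *
        (4^m / ((2*m).factorial : ℝ) * ∏ i ∈ Finset.range m, (2 * (i : ℝ) + 1) / (2 * i + 2)) := by
      field_simp
    rw [h3, h2]
    ring
  rw [he]
  exact this

lemma int_pow_exp (m k : ℕ) (hk : 1 ≤ k) :
    ∫ t in Set.Ioi (0:ℝ), t^m * Real.exp (-(k * t)) = (m.factorial : ℝ) / (k:ℝ)^(m+1) := by
  have hk0 : (0:ℝ) < k := by exact_mod_cast hk
  have h := Real.integral_rpow_mul_exp_neg_mul_Ioi (a := (m:ℝ)+1) (r := k) (by positivity) hk0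
  rw [Real.Gamma_nat_eq_factorial] at h
  simp only [add_sub_cancel_right, Real.rpow_natCast] at h
  rw [h]
  rw [show ((m:ℝ)+1) = ((m+1 : ℕ) : ℝ) by push_cast; rfl, Real.rpow_natCast]
  rw [one_div, inv_pow]
  field_simp

lemma integrable_pow_exp (m k : ℕ) (hk : 1 ≤ k) :
    MeasureTheory.IntegrableOn (fun t : ℝ => t^m * Real.exp (-(k * t))) (Set.Ioi 0) := by
  apply MeasureTheory.Integrable.of_integral_ne_zero
  rw [int_pow_exp m k hk]
  have hk0 : (0:ℝ) < k := by exact_mod_cast hk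
  positivity

lemma int_besF_exp (k : ℕ) (hk : 1 ≤ k) :
    ∫ t in Set.Ioi (0:ℝ), besF t * Real.exp (-(k * t)) = Real.exp (-(1 / (k:ℝ))) / k := by
  have hk0 : (0:ℝ) < k := by exact_mod_cast hk
  have hval : ∀ m : ℕ, ∫ t in Set.Ioi (0:ℝ), ((-1:ℝ)^m / ((m.factorial : ℝ))^2) * (t^m * Real.exp (-(k * t)))
      = (-(1 / (k:ℝ)))^m / (m.factorial : ℝ) / k := by
    intro m
    rw [MeasureTheory.integral_const_mul, int_pow_exp m k hk]
    have : (m.factorial : ℝ) ≠ 0 := by positivity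
    rw [neg_pow (1 / (k:ℝ)), one_div, inv_pow, pow_succ]
    field_simp
    try ring
  have hnorm : ∀ m : ℕ, ∫ t in Set.Ioi (0:ℝ), ‖((-1:ℝ)^m / ((m.factorial : ℝ))^2) * (t^m * Real.exp (-(k * t)))‖
      = (1 / (k:ℝ))^m / (m.factorial : ℝ) / k := by
    intro m
    have : ∫ t in Set.Ioi (0:ℝ), ‖((-1:ℝ)^m / ((m.factorial : ℝ))^2) * (t^m * Real.exp (-(k * t)))‖
        = ∫ t in Set.Ioi (0:ℝ), (1 / ((m.factorial : ℝ))^2) * (t^m * Real.exp (-(k * t))) := by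
      apply MeasureTheory.setIntegral_congr_fun measurableSet_Ioi
      intro t ht
      have ht : 0 < t := ht
      have h0 : 0 ≤ t^m * Real.exp (-(k * t)) := by positivity
      simp only [norm_mul, norm_div, norm_pow, norm_neg, norm_one, one_pow, Real.norm_natCast]
      rw [Real.norm_eq_abs, Real.norm_eq_abs, abs_of_pos ht, abs_of_pos (Real.exp_pos _)]
    rw [this, MeasureTheory.integral_const_mul, int_pow_exp m k hk]
    have : (m.factorial : ℝ) ≠ 0 := by positivity
    rw [one_div_pow, pow_succ]
    field_simp
    try ring
  have h := MeasureTheory.hasSum_integral_of_summable_integral_norm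
    (μ := MeasureTheory.volume.restrict (Set.Ioi (0:ℝ)))
    (F := fun (m : ℕ) (t : ℝ) => ((-1:ℝ)^m / ((m.factorial : ℝ))^2) * (t^m * Real.exp (-(k * t))))
    (fun m => (integrable_pow_exp m k hk).const_mul _) (by
      simp_rw [hnorm]
      exact (Real.summable_pow_div_factorial _).div_const _)
  simp_rw [hval] at h
  have h2 : HasSum (fun m : ℕ => (-(1 / (k:ℝ)))^m / (m.factorial : ℝ) / k) (Real.exp (-(1 / (k:ℝ))) / k) := by
    apply HasSum.div_const
    rw [Real.exp_eq_exp_ℝ]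
    exact NormedSpace.expSeries_div_hasSum_exp _
  rw [← h.unique h2]
  apply MeasureTheory.setIntegral_congr_fun measurableSet_Ioi
  intro t ht
  have h3 := (besF_hasSum t (le_of_lt ht)).mul_right (Real.exp (-(k*t)))
  simp only
  rw [← h3.tsum_eq]
  congr 1
  funext m
  ring

lemma binom_deriv (n : ℕ) (t : ℝ) : (n:ℝ) * Real.exp (-t) * (1 - Real.exp (-t))^(n-1) =
    ∑ k ∈ Finset.Icc 1 n, (-((n.choose k : ℝ) * (-1)^k) * k) * Real.exp (-(k*t)) := by
  rcases n with _ | n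
  · simp
  have hI : Finset.Icc 1 (n+1) = (Finset.range (n+1)).map (addRightEmbedding 1) := by
    rw [Finset.range_eq_Ico, Finset.map_add_right_Ico]
    rfl
  rw [hI, Finset.sum_map]
  have h : (1 - Real.exp (-t))^n = ∑ j ∈ Finset.range (n+1), (-Real.exp (-t))^j * (n.choose j : ℝ) := by
    rw [show 1 - Real.exp (-t) = -Real.exp (-t) + 1 by ring, add_pow]
    simp
  rw [Nat.add_sub_cancel, h, Finset.mul_sum]
  apply Finset.sum_congr rfl
  intro j _
  have h2 : ((n+1).choose (j+1) : ℝ) * (j+1) = (n+1) * (n.choose j : ℝ) := by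
    exact_mod_cast (Nat.add_one_mul_choose_eq n j).symm
  have h3 : Real.exp (-(((j+1 : ℕ):ℝ)*t)) = Real.exp (-t) * (Real.exp (-t))^j := by
    rw [← Real.exp_nat_mul, ← Real.exp_add]
    congr 1; push_cast; ring
  simp only [addRightEmbedding_apply]
  rw [h3, neg_pow (Real.exp (-t))]
  push_cast
  rw [pow_succ]
  linear_combination (-1:ℝ)^j * Real.exp (-t) * (Real.exp (-t))^j * (-h2)

lemma int_binom (f : ℝ → ℝ) (a : ℕ → ℝ) (n : ℕ)
    (hint : ∀ k : ℕ, 1 ≤ k → MeasureTheory.IntegrableOn (fun t : ℝ => f t * Real.exp (-(k * t))) (Set.Ioi 0))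
    (hf : ∀ k : ℕ, 1 ≤ k → ∫ t in Set.Ioi (0:ℝ), f t * Real.exp (-(k * t)) = a k / k) :
    ∫ t in Set.Ioi (0:ℝ), f t * ((n:ℝ) * Real.exp (-t) * (1 - Real.exp (-t))^(n-1)) =
      - ∑ k ∈ Finset.Icc 1 n, (n.choose k : ℝ) * (-1)^k * a k := by
  have h1 : ∀ t : ℝ, f t * ((n:ℝ) * Real.exp (-t) * (1 - Real.exp (-t))^(n-1)) =
      ∑ k ∈ Finset.Icc 1 n, (-((n.choose k : ℝ) * (-1)^k) * k) * (f t * Real.exp (-(k*t))) := by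
    intro t
    rw [binom_deriv, Finset.mul_sum]
    apply Finset.sum_congr rfl
    intros; ring
  simp_rw [h1]
  rw [MeasureTheory.integral_finsetSum, ← Finset.sum_neg_distrib]
  · apply Finset.sum_congr rfl
    intro k hk
    have hk1 := (Finset.mem_Icc.mp hk).1
    have hk0 : (0:ℝ) < k := by exact_mod_cast hk1
    rw [MeasureTheory.integral_const_mul, hf k hk1]
    field_simp
  · intro k hk
    exact (hint k (Finset.mem_Icc.mp hk).1).const_mul _

lemma integrable_exp_k (k : ℕ) (hk : 1 ≤ k) :
    MeasureTheory.IntegrableOn (fun t : ℝ => Real.exp (-(k * t))) (Set.Ioi 0) := by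
  simpa using integrable_pow_exp 0 k hk

lemma integrable_besF_exp (k : ℕ) (hk : 1 ≤ k) :
    MeasureTheory.IntegrableOn (fun t : ℝ => besF t * Real.exp (-(k * t))) (Set.Ioi 0) := by
  refine MeasureTheory.Integrable.mono' (integrable_exp_k k hk) ?_ ?_
  · apply Continuous.aestronglyMeasurable
    have := besF_continuous
    fun_prop
  · refine Eventually.of_forall fun t => ?_
    rw [norm_mul, Real.norm_eq_abs, Real.norm_eq_abs, abs_of_pos (Real.exp_pos _)]
    exact mul_le_of_le_one_left (Real.exp_pos _).le (besF_abs_le t)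

lemma int_besF (n : ℕ) :
    ∫ t in Set.Ioi (0:ℝ), besF t * ((n:ℝ) * Real.exp (-t) * (1 - Real.exp (-t))^(n-1)) =
      - ∑ k ∈ Finset.Icc 1 n, (n.choose k : ℝ) * (-1)^k * Real.exp (-(1 / (k:ℝ))) :=
  int_binom besF (fun k => Real.exp (-(1 / (k:ℝ)))) n integrable_besF_exp int_besF_exp

lemma int_one (n : ℕ) (hn : 1 ≤ n) :
    ∫ t in Set.Ioi (0:ℝ), ((n:ℝ) * Real.exp (-t) * (1 - Real.exp (-t))^(n-1)) = 1 := by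
  have h := int_binom (fun _ => 1) (fun _ => 1) n (fun k hk => by simpa using integrable_exp_k k hk)
    (fun k hk => by simpa using int_pow_exp 0 k hk)
  simp only [one_mul, mul_one] at h
  rw [h]
  have h2 : ∑ k ∈ Finset.range (n+1), (n.choose k : ℝ) * (-1)^k = 0 := by
    have := Int.alternating_sum_range_choose_of_ne (n := n) (by omega)
    have h3 : ((∑ m ∈ Finset.range (n + 1), (-1 : ℤ) ^ m * (n.choose m : ℤ) : ℤ) : ℝ) = 0 := by
      rw [this]; simp
    push_cast at h3
    rw [← h3]
    exact Finset.sum_congr rfl fun _ _ => mul_comm _ _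
  have hI : Finset.range (n+1) = insert 0 (Finset.Icc 1 n) := by
    ext k; simp; omega
  rw [hI, Finset.sum_insert (by simp)] at h2
  simp at h2
  linarith

lemma osc_norm (x φ : ℝ) : ‖Complex.exp (-2 * Complex.I * x * (Real.sin φ : ℂ)^2)‖ = 1 := by
  rw [show -2 * Complex.I * (x:ℂ) * (Real.sin φ : ℂ)^2 = ((-2 * x * Real.sin φ ^2 : ℝ) : ℂ) * Complex.I by
    push_cast; ring]
  exact Complex.norm_exp_ofReal_mul_I _

lemma osc_rem : ∃ C : ℝ, ∀ x : ℝ, 0 < x →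
    ‖∫ φ in (0:ℝ)..(Real.pi/4), Complex.exp (-2 * Complex.I * x * (Real.sin φ : ℂ)^2) *
      ((1 - Real.cos φ : ℝ) : ℂ)‖ ≤ C / x := by
  have hp := Real.pi_pos
  set u : ℝ → ℝ := fun φ => Real.sin φ / (2 * Real.cos φ * (1 + Real.cos φ)) with hu
  set u' : ℝ → ℝ := fun φ => (Real.cos φ * (2 * Real.cos φ * (1 + Real.cos φ)) - Real.sin φ *
    ((2 * -Real.sin φ) * (1 + Real.cos φ) + (2 * Real.cos φ) * (-Real.sin φ))) /
      (2 * Real.cos φ * (1 + Real.cos φ))^2 with hu'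
  have hcos : ∀ φ ∈ Set.Icc 0 (Real.pi/4), 0 < Real.cos φ := by
    intro φ hφ
    apply Real.cos_pos_of_mem_Ioo
    constructor <;> linarith [hφ.1, hφ.2]
  have hden : ∀ φ ∈ Set.Icc 0 (Real.pi/4), 2 * Real.cos φ * (1 + Real.cos φ) ≠ 0 := by
    intro φ hφ
    have := hcos φ hφ
    positivity
  have hd : ∀ φ ∈ Set.Icc 0 (Real.pi/4), HasDerivAt u (u' φ) φ := by
    intro φ hφ
    exact (Real.hasDerivAt_sin φ).div (((Real.hasDerivAt_cos φ).const_mul 2).mul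
      ((Real.hasDerivAt_cos φ).const_add 1)) (hden φ hφ)
  have hcu' : ContinuousOn u' (Set.Icc 0 (Real.pi/4)) := by
    apply ContinuousOn.div (by fun_prop) (by fun_prop)
    intro φ hφ
    exact pow_ne_zero _ (hden φ hφ)
  obtain ⟨K, hK⟩ := isCompact_Icc.exists_bound_of_continuousOn hcu'
  refine ⟨|u (Real.pi/4)| + K * (Real.pi/4), fun x hx => ?_⟩
  have hxC : (x:ℂ) ≠ 0 := by exact_mod_cast hx.ne'
  set v : ℝ → ℂ := fun φ => Complex.exp (-2 * Complex.I * x * (Real.sin φ : ℂ)^2) / (-2 * Complex.I * x) with hv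
  set v' : ℝ → ℂ := fun φ => Complex.exp (-2 * Complex.I * x * (Real.sin φ : ℂ)^2) *
    (2 * Real.sin φ * Real.cos φ) with hv'
  have hvn : ∀ φ, ‖v φ‖ ≤ 1 / x := by
    intro φ
    simp only [hv]
    rw [norm_div, osc_norm]
    simp only [norm_mul, norm_neg, Complex.norm_I, Complex.norm_ofNat, Complex.norm_real, Real.norm_eq_abs,
      abs_of_pos hx]
    apply one_div_le_one_div_of_le hx
    linarith
  have hdv : ∀ φ : ℝ, HasDerivAt v (v' φ) φ := by
    intro φ
    have h1 : HasDerivAt (fun φ : ℝ => (Real.sin φ : ℂ)) (Real.cos φ : ℂ) φ :=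
      (Real.hasDerivAt_sin φ).ofReal_comp
    have h2 := (((h1.pow 2).const_mul (-2 * Complex.I * (x:ℂ))).cexp).div_const (-2 * Complex.I * x)
    refine h2.congr_deriv ?_
    simp only [hv']
    have : Complex.I ≠ 0 := Complex.I_ne_zero
    field_simp
    simp
    ring
  have hIcc : Set.uIcc 0 (Real.pi/4) = Set.Icc 0 (Real.pi/4) := Set.uIcc_of_le (by positivity)
  have hcuC : ContinuousOn (fun φ => (u' φ : ℂ)) (Set.uIcc 0 (Real.pi/4)) := by
    rw [hIcc]
    exact Complex.continuous_ofReal.comp_continuousOn hcu'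
  have hcv' : Continuous v' := by
    simp only [hv']; fun_prop
  have hP := intervalIntegral.integral_mul_deriv_eq_deriv_mul (u := fun φ => (u φ : ℂ)) (v := v)
    (u' := fun φ => (u' φ : ℂ)) (v' := v') (a := 0) (b := Real.pi/4)
    (fun φ hφ => (hd φ (hIcc ▸ hφ)).ofReal_comp) (fun φ _ => hdv φ) hcuC.intervalIntegrable
    (hcv'.intervalIntegrable _ _)
  have hE : ∫ φ in (0:ℝ)..(Real.pi/4), Complex.exp (-2 * Complex.I * x * (Real.sin φ : ℂ)^2) *
      ((1 - Real.cos φ : ℝ) : ℂ) = ∫ φ in (0:ℝ)..(Real.pi/4), (u φ : ℂ) * v' φ := by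
    apply intervalIntegral.integral_congr
    intro φ hφ
    rw [hIcc] at hφ
    have h1 : (1 - Real.cos φ : ℝ) = u φ * (2 * Real.sin φ * Real.cos φ) := by
      have h2 := hden φ hφ
      simp only [hu]
      rw [div_mul_eq_mul_div, eq_div_iff h2]
      linear_combination (-2 * Real.cos φ) * Real.sin_sq_add_cos_sq φ
    simp only [h1, hv']
    push_cast
    ring
  rw [hE, hP]
  have hu0 : u 0 = 0 := by simp [hu]
  have hI : ‖∫ φ in (0:ℝ)..(Real.pi/4), (u' φ : ℂ) * v φ‖ ≤ (K * (1/x)) * |Real.pi/4 - 0| := by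
    apply intervalIntegral.norm_integral_le_of_norm_le_const
    intro φ hφ
    rw [Set.uIoc_of_le (by positivity)] at hφ
    have h1 := hK φ ⟨hφ.1.le, hφ.2⟩
    rw [norm_mul, Complex.norm_real]
    exact mul_le_mul h1 (hvn φ) (norm_nonneg _) ((norm_nonneg _).trans h1)
  rw [sub_zero, abs_of_pos (by positivity : 0 < Real.pi/4)] at hI
  rw [hu0]
  simp only [Complex.ofReal_zero, zero_mul, sub_zero]
  refine (norm_sub_le _ _).trans ?_
  have h5 : ‖(u (Real.pi/4) : ℂ) * v (Real.pi/4)‖ ≤ |u (Real.pi/4)| * (1/x) := by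
    rw [norm_mul, Complex.norm_real, Real.norm_eq_abs]
    exact mul_le_mul_of_nonneg_left (hvn _) (abs_nonneg _)
  calc _ ≤ |u (Real.pi/4)| * (1/x) + (K * (1/x)) * (Real.pi/4) := add_le_add h5 hI
    _ = _ := by ring

lemma osc_main (x : ℝ) (hx : 0 < x) :
    ∫ φ in (0:ℝ)..(Real.pi/4), Complex.exp (-2 * Complex.I * x * (Real.sin φ : ℂ)^2) * (Real.cos φ : ℂ)
    = ((Real.sqrt (2*x))⁻¹ : ℝ) * ∫ y in (0:ℝ)..(Real.sqrt x), Complex.exp (-Complex.I * (y:ℂ) ^ 2) := by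
  have h1 := intervalIntegral.integral_deriv_smul_comp (a := 0) (b := Real.pi/4) (f := Real.sin) (f' := Real.cos)
    (g := fun v : ℝ => Complex.exp (-2 * Complex.I * x * (v : ℂ)^2))
    (fun φ _ => Real.hasDerivAt_sin φ) (by fun_prop) (by fun_prop)
  have h2 := intervalIntegral.integral_comp_mul_left (a := 0) (b := Real.sqrt 2 / 2) (c := Real.sqrt (2*x))
    (fun y : ℝ => Complex.exp (-Complex.I * (y:ℂ) ^ 2)) (by positivity)
  have h3 : Real.sqrt (2*x) * (Real.sqrt 2 / 2) = Real.sqrt x := by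
    rw [Real.sqrt_mul (by norm_num)]
    have := Real.mul_self_sqrt (show (0:ℝ) ≤ 2 by norm_num)
    linear_combination (Real.sqrt x / 2) * this
  rw [mul_zero, h3] at h2
  rw [Real.sin_zero, Real.sin_pi_div_four] at h1
  have h4 : ∀ y : ℝ, -Complex.I * ((Real.sqrt (2*x) * y : ℝ) : ℂ)^2 = -2 * Complex.I * x * (y:ℂ)^2 := by
    intro y
    have : (Real.sqrt (2*x) * y)^2 = 2 * x * y^2 := by
      rw [mul_pow, Real.sq_sqrt (by positivity)]
    rw [← Complex.ofReal_pow, this]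
    push_cast; ring
  simp_rw [h4] at h2
  rw [h2] at h1
  rw [Complex.real_smul] at h1
  rw [← h1]
  apply intervalIntegral.integral_congr
  intro φ _
  simp only [Function.comp, Complex.real_smul]
  ring

noncomputable def oscA (x : ℝ) : ℂ :=
  ∫ φ in (0:ℝ)..(Real.pi/4), Complex.exp (-2 * Complex.I * x * (Real.sin φ : ℂ)^2)

noncomputable def oscC : ℂ := ((Real.sqrt 2)⁻¹ : ℝ) *
  (((Real.sqrt Real.pi / 2 : ℝ) : ℂ) * Complex.exp (-(Real.pi / 4 : ℝ) * Complex.I))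

lemma oscA_tendsto : Tendsto (fun x : ℝ => (Real.sqrt x : ℂ) * oscA x - oscC) atTop (𝓝 0) := by
  obtain ⟨C, hC⟩ := osc_rem
  have hlim : Tendsto (fun x : ℝ => (1 + C) / Real.sqrt x) atTop (𝓝 0) :=
    Tendsto.const_div_atTop Real.tendsto_sqrt_atTop _
  refine squeeze_zero_norm' ?_ hlim
  filter_upwards [eventually_gt_atTop 0] with x hx
  have hs : 0 < Real.sqrt x := Real.sqrt_pos.mpr hx
  have h1 : oscA x = (∫ φ in (0:ℝ)..(Real.pi/4), Complex.exp (-2 * Complex.I * x * (Real.sin φ : ℂ)^2) * (Real.cos φ : ℂ))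
     + ∫ φ in (0:ℝ)..(Real.pi/4), Complex.exp (-2 * Complex.I * x * (Real.sin φ : ℂ)^2) *
      ((1 - Real.cos φ : ℝ) : ℂ) := by
    rw [← intervalIntegral.integral_add]
    · unfold oscA
      apply intervalIntegral.integral_congr
      intro φ _
      simp only
      push_cast
      ring
    · apply Continuous.intervalIntegrable; fun_prop
    · apply Continuous.intervalIntegrable; fun_prop
  rw [h1, osc_main x hx]
  have hF := fres (Real.sqrt x) hs
  set J := ∫ y in (0:ℝ)..(Real.sqrt x), Complex.exp (-Complex.I * (y:ℂ) ^ 2)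
  have hR := hC x hx
  set R := ∫ φ in (0:ℝ)..(Real.pi/4), Complex.exp (-2 * Complex.I * x * (Real.sin φ : ℂ)^2) *
      ((1 - Real.cos φ : ℝ) : ℂ)
  have h2 : (Real.sqrt x) * (Real.sqrt (2*x))⁻¹ = (Real.sqrt 2)⁻¹ := by
    rw [Real.sqrt_mul (by norm_num)]
    field_simp
  have h3 : (Real.sqrt x : ℂ) * ((Real.sqrt (2*x))⁻¹ : ℝ) = ((Real.sqrt 2)⁻¹ : ℝ) := by
    rw [← h2]; push_cast; rfl
  have h4 : (Real.sqrt x : ℂ) * (((Real.sqrt (2*x))⁻¹ : ℝ) * J + R) - oscC =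
      ((Real.sqrt 2)⁻¹ : ℝ) * (J - ((Real.sqrt Real.pi / 2 : ℝ) : ℂ) *
        Complex.exp (-(Real.pi / 4 : ℝ) * Complex.I)) + (Real.sqrt x : ℂ) * R := by
    rw [mul_add, ← mul_assoc, h3]
    unfold oscC
    ring
  rw [h4]
  refine (norm_add_le _ _).trans ?_
  rw [norm_mul, norm_mul, Complex.norm_real, Complex.norm_real, Real.norm_eq_abs, Real.norm_eq_abs,
    abs_of_pos hs, abs_of_pos (by positivity)]
  have h5 : (Real.sqrt 2)⁻¹ ≤ 1 := inv_le_one_of_one_le₀ (Real.one_le_sqrt.mpr (by norm_num))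
  have h6 : Real.sqrt x * (C / x) = C / Real.sqrt x := by
    nth_rewrite 2 [← Real.mul_self_sqrt hx.le]
    field_simp
  calc _ ≤ 1 * (1 / Real.sqrt x) + Real.sqrt x * (C / x) := by
        apply add_le_add
        · exact mul_le_mul h5 hF (norm_nonneg _) (by norm_num)
        · exact mul_le_mul_of_nonneg_left hR hs.le
    _ = _ := by rw [h6]; ring

lemma besF_eq (t : ℝ) : besF t = (4 / Real.pi) *
    (Complex.exp ((2 * Real.sqrt t : ℝ) * Complex.I) * oscA (2 * Real.sqrt t)).re := by
  set x := 2 * Real.sqrt t with hx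
  unfold besF oscA
  rw [← hx]
  have hc : Continuous (fun φ : ℝ => Complex.exp ((x:ℝ) * Complex.I) *
      Complex.exp (-2 * Complex.I * x * (Real.sin φ : ℂ)^2)) := by fun_prop
  have h1 := Complex.reCLM.intervalIntegral_comp_comm (hc.intervalIntegrable (μ := MeasureTheory.volume) 0 (Real.pi/4))
  simp only [Complex.reCLM_apply] at h1
  rw [← intervalIntegral.integral_const_mul (Complex.exp ((x:ℝ) * Complex.I)), ← h1]
  have h2 := intervalIntegral.integral_comp_mul_left (a := 0) (b := Real.pi/4) (c := 2)
    (fun θ : ℝ => Real.cos (x * Real.cos θ)) (by norm_num)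
  rw [mul_zero, show 2 * (Real.pi/4) = Real.pi/2 by ring, smul_eq_mul] at h2
  have h3 : ∀ φ : ℝ, (Complex.exp ((x:ℝ) * Complex.I) *
      Complex.exp (-2 * Complex.I * x * (Real.sin φ : ℂ)^2)).re = Real.cos (x * Real.cos (2 * φ)) := by
    intro φ
    rw [← Complex.exp_add, Real.cos_two_mul, Real.cos_sq']
    rw [show (x:ℂ) * Complex.I + -2 * Complex.I * x * (Real.sin φ : ℂ)^2 =
      ((x * (2 * (1 - Real.sin φ ^2) - 1) : ℝ) : ℂ) * Complex.I by push_cast; ring]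
    exact Complex.exp_ofReal_mul_I_re _
  simp_rw [h3]
  rw [h2]
  ring

lemma besF_asymp : Tendsto (fun t : ℝ => t ^ ((1:ℝ)/4) * besF t -
    Real.cos (2 * Real.sqrt t - Real.pi / 4) / Real.sqrt Real.pi) atTop (𝓝 0) := by
  have hp := Real.pi_pos
  have hx : Tendsto (fun t : ℝ => 2 * Real.sqrt t) atTop atTop :=
    Real.tendsto_sqrt_atTop.const_mul_atTop (by norm_num)
  have h := (oscA_tendsto.comp hx).norm.const_mul (4 / (Real.pi * Real.sqrt 2))
  rw [norm_zero, mul_zero] at h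
  refine squeeze_zero_norm' ?_ h
  filter_upwards [eventually_gt_atTop 0] with t ht
  simp only [Function.comp]
  rw [besF_eq]
  set x := 2 * Real.sqrt t with hx
  have h1 : t ^ ((1:ℝ)/4) = Real.sqrt x / Real.sqrt 2 := by
    rw [hx, Real.sqrt_mul (by norm_num), mul_div_cancel_left₀ _ (by positivity)]
    rw [Real.sqrt_eq_rpow, Real.sqrt_eq_rpow, ← Real.rpow_mul ht.le]
    norm_num
  have h2 : (Complex.exp ((x:ℝ) * Complex.I) * oscC).re =
      (Real.sqrt 2)⁻¹ * (Real.sqrt Real.pi / 2) * Real.cos (x - Real.pi/4) := by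
    have : Complex.exp ((x:ℝ) * Complex.I) * oscC = (((Real.sqrt 2)⁻¹ * (Real.sqrt Real.pi / 2) : ℝ) : ℂ) *
        Complex.exp ((x - Real.pi/4 : ℝ) * Complex.I) := by
      rw [show ((x - Real.pi/4 : ℝ) : ℂ) * Complex.I = (x:ℝ) * Complex.I + -(Real.pi / 4 : ℝ) * Complex.I by
        push_cast; ring, Complex.exp_add]
      unfold oscC
      push_cast
      ring
    rw [this, Complex.re_ofReal_mul, Complex.exp_ofReal_mul_I_re]
  have h3 : (Complex.exp ((x:ℝ) * Complex.I) * ((Real.sqrt x : ℂ) * oscA x)).re =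
      Real.sqrt x * (Complex.exp ((x:ℝ) * Complex.I) * oscA x).re := by
    rw [← Complex.re_ofReal_mul]
    congr 1; ring
  have h4 : t ^ ((1:ℝ)/4) * (4 / Real.pi * (Complex.exp ((x:ℝ) * Complex.I) * oscA x).re) -
      Real.cos (x - Real.pi/4) / Real.sqrt Real.pi = 4 / (Real.pi * Real.sqrt 2) *
      (Complex.exp ((x:ℝ) * Complex.I) * ((Real.sqrt x : ℂ) * oscA x - oscC)).re := by
    rw [mul_sub, Complex.sub_re, h2, h3, h1]
    have e1 := Real.mul_self_sqrt (show (0:ℝ) ≤ 2 by norm_num)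
    have e2 := Real.mul_self_sqrt hp.le
    have e3 : 4 / (Real.pi * Real.sqrt 2) * ((Real.sqrt 2)⁻¹ * (Real.sqrt Real.pi / 2) * Real.cos (x - Real.pi/4))
        = Real.cos (x - Real.pi/4) / Real.sqrt Real.pi := by
      have : 4 / (Real.pi * Real.sqrt 2) * ((Real.sqrt 2)⁻¹ * (Real.sqrt Real.pi / 2) * Real.cos (x - Real.pi/4))
        = 4 / ((Real.sqrt Real.pi * Real.sqrt Real.pi) * (Real.sqrt 2 * Real.sqrt 2)) * ((Real.sqrt Real.pi / 2) * Real.cos (x - Real.pi/4)) := by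
        rw [e2]
        field_simp
      rw [this, e1]
      field_simp
      norm_num
    rw [mul_sub, e3]
    congr 1
    field_simp
  rw [h4, norm_mul, Real.norm_eq_abs, abs_of_pos (by positivity)]
  apply mul_le_mul_of_nonneg_left _ (by positivity)
  refine (Complex.abs_re_le_norm _).trans ?_
  rw [norm_mul, Complex.norm_exp_ofReal_mul_I, one_mul]

lemma main_abs_le (y : ℝ) : |Real.cos y / Real.sqrt Real.pi| ≤ 1 := by
  have h1 : 1 ≤ Real.sqrt Real.pi := Real.one_le_sqrt.mpr (by linarith [Real.pi_gt_three])
  rw [abs_div, abs_of_pos (by linarith : 0 < Real.sqrt Real.pi)]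
  apply div_le_one_of_le₀ _ (by linarith)
  exact (Real.abs_cos_le_one _).trans h1

lemma besF_bound : ∃ C : ℝ, 0 ≤ C ∧ ∀ t : ℝ, 0 ≤ t → t ^ ((1:ℝ)/4) * |besF t| ≤ C := by
  have h := besF_asymp.abs
  rw [abs_zero] at h
  have h1 := h.eventually (gt_mem_nhds (zero_lt_one))
  obtain ⟨T, hT⟩ := eventually_atTop.mp h1
  refine ⟨2 + (max T 0) ^ ((1:ℝ)/4), by positivity, fun t ht => ?_⟩
  have hpow : 0 ≤ t ^ ((1:ℝ)/4) := by positivity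
  rcases le_total T t with h2 | h2
  · have h3 := hT t h2
    have h4 := main_abs_le (2 * Real.sqrt t - Real.pi / 4)
    have h5 : t ^ ((1:ℝ)/4) * |besF t| = |t ^ ((1:ℝ)/4) * besF t| := by
      rw [abs_mul, abs_of_nonneg hpow]
    rw [h5]
    have h6 : 0 ≤ (max T 0) ^ ((1:ℝ)/4) := by positivity
    have h7 := abs_sub_abs_le_abs_sub (t ^ ((1:ℝ)/4) * besF t) (Real.cos (2 * Real.sqrt t - Real.pi / 4) / Real.sqrt Real.pi)
    linarith
  · have h3 : t ^ ((1:ℝ)/4) ≤ (max T 0) ^ ((1:ℝ)/4) :=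
      Real.rpow_le_rpow ht (h2.trans (le_max_left _ _)) (by norm_num)
    have h4 := mul_le_of_le_one_right hpow (besF_abs_le t)
    linarith

lemma quarter_sub (a b : ℝ) (ha : 0 ≤ a) (hb : 0 ≤ b) :
    a ^ ((1:ℝ)/4) ≤ b ^ ((1:ℝ)/4) + (1 + |a - b|) := by
  have h1 : a ≤ b + |a - b| := by linarith [le_abs_self (a - b)]
  have h2 : a ^ ((1:ℝ)/4) ≤ (b + |a-b|) ^ ((1:ℝ)/4) := Real.rpow_le_rpow ha h1 (by norm_num)
  have h3 := Real.rpow_add_le_add_rpow (p := (1:ℝ)/4) hb (abs_nonneg (a-b)) (by norm_num) (by norm_num)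
  have h4 : |a - b| ^ ((1:ℝ)/4) ≤ 1 + |a - b| := by
    calc |a - b| ^ ((1:ℝ)/4) ≤ (1 + |a-b|) ^ ((1:ℝ)/4) :=
          Real.rpow_le_rpow (abs_nonneg _) (by linarith) (by norm_num)
      _ ≤ (1 + |a-b|) ^ (1:ℝ) := Real.rpow_le_rpow_of_exponent_le (by linarith [abs_nonneg (a-b)]) (by norm_num)
      _ = _ := Real.rpow_one _
  linarith

lemma besF_tendsto : Tendsto besF atTop (𝓝 0) := by
  obtain ⟨C, hC0, hC⟩ := besF_bound
  have h : Tendsto (fun t : ℝ => C / t ^ ((1:ℝ)/4)) atTop (𝓝 0) :=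
    Tendsto.const_div_atTop (tendsto_rpow_atTop (by norm_num)) _
  refine squeeze_zero_norm' ?_ h
  filter_upwards [eventually_gt_atTop 0] with t ht
  rw [le_div_iff₀ (by positivity), mul_comm]
  exact hC t ht.le

lemma sqrt_shift (x : ℝ) : Tendsto (fun L : ℝ => Real.cos (2 * Real.sqrt (L + x) - Real.pi / 4) -
    Real.cos (2 * Real.sqrt L - Real.pi / 4)) atTop (𝓝 0) := by
  have h : Tendsto (fun L : ℝ => (2 * |x|) / Real.sqrt L) atTop (𝓝 0) :=
    Tendsto.const_div_atTop Real.tendsto_sqrt_atTop _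
  refine squeeze_zero_norm' ?_ h
  filter_upwards [eventually_gt_atTop 0, eventually_gt_atTop (-x)] with L hL hLx
  have hs : 0 < Real.sqrt L := Real.sqrt_pos.mpr hL
  have h1 : |Real.cos (2 * Real.sqrt (L + x) - Real.pi / 4) - Real.cos (2 * Real.sqrt L - Real.pi / 4)|
      ≤ |(2 * Real.sqrt (L + x) - Real.pi / 4) - (2 * Real.sqrt L - Real.pi / 4)| := by
    have := Real.lipschitzWith_cos.dist_le_mul (2 * Real.sqrt (L + x) - Real.pi / 4) (2 * Real.sqrt L - Real.pi / 4)
    simpa [Real.dist_eq] using this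
  refine h1.trans ?_
  rw [show (2 * Real.sqrt (L + x) - Real.pi / 4) - (2 * Real.sqrt L - Real.pi / 4) =
    2 * (Real.sqrt (L+x) - Real.sqrt L) by ring, abs_mul, abs_two, mul_div_assoc]
  apply mul_le_mul_of_nonneg_left _ (by norm_num)
  rw [le_div_iff₀ hs]
  have h2 : x = (Real.sqrt (L+x) - Real.sqrt L) * (Real.sqrt (L+x) + Real.sqrt L) := by
    have e1 := Real.mul_self_sqrt hL.le
    have e2 := Real.mul_self_sqrt (show 0 ≤ L + x by linarith)
    linear_combination e1 - e2
  have h3 : |x| = |Real.sqrt (L+x) - Real.sqrt L| * (Real.sqrt (L+x) + Real.sqrt L) := by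
    conv_lhs => rw [h2]
    rw [abs_mul, abs_of_pos (by positivity : 0 < Real.sqrt (L+x) + Real.sqrt L)]
  rw [h3]
  apply mul_le_mul_of_nonneg_left _ (abs_nonneg _)
  linarith [Real.sqrt_nonneg (L+x)]

lemma pointwise (x : ℝ) : Tendsto (fun L : ℝ => L ^ ((1:ℝ)/4) * besF (x + L) -
    Real.cos (2 * Real.sqrt L - Real.pi / 4) / Real.sqrt Real.pi) atTop (𝓝 0) := by
  have hsh : Tendsto (fun L : ℝ => L + x) atTop atTop := tendsto_atTop_add_const_right _ _ tendsto_id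
  have h1 := besF_asymp.comp hsh
  have h2 := (sqrt_shift x).div_const (Real.sqrt Real.pi)
  have h3 : Tendsto (fun L : ℝ => (L ^ ((1:ℝ)/4) - (L + x) ^ ((1:ℝ)/4)) * besF (L + x)) atTop (𝓝 0) := by
    have h4 := ((besF_tendsto.comp hsh).abs).const_mul (1 + |x|)
    rw [abs_zero, mul_zero] at h4
    refine squeeze_zero_norm' ?_ h4
    filter_upwards [eventually_gt_atTop 0, eventually_gt_atTop (-x)] with L hL hLx
    rw [norm_mul]
    refine mul_le_mul_of_nonneg_right ?_ (norm_nonneg _)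
    have a1 := quarter_sub L (L+x) hL.le (by linarith)
    have a2 := quarter_sub (L+x) L (by linarith) hL.le
    rw [show L - (L+x) = -x by ring, abs_neg] at a1
    rw [show (L+x) - L = x by ring] at a2
    rw [Real.norm_eq_abs, abs_le]
    constructor <;> linarith
  have h5 := (h1.add h2).add h3
  rw [zero_div, zero_add, zero_add] at h5
  refine h5.congr fun L => ?_
  simp only [Function.comp]
  rw [add_comm x L]
  ring

lemma weight_bound (n : ℕ) (hn : 2 ≤ n) (x : ℝ) (hx : 0 < x + Real.log n) :
    0 ≤ (n:ℝ) * Real.exp (-(x + Real.log n)) * (1 - Real.exp (-(x + Real.log n)))^(n-1) ∧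
    (n:ℝ) * Real.exp (-(x + Real.log n)) * (1 - Real.exp (-(x + Real.log n)))^(n-1) ≤ 8 * Real.exp (-|x|) := by
  have hn0 : (0:ℝ) < n := by positivity
  have hn2 : (2:ℝ) ≤ n := by exact_mod_cast hn
  set q := Real.exp (-(x + Real.log n)) with hq
  have hq0 : 0 < q := Real.exp_pos _
  have hq1 : q ≤ 1 := Real.exp_le_one_iff.mpr (by linarith)
  have hnq : (n:ℝ) * q = Real.exp (-x) := by
    rw [hq, neg_add, Real.exp_add, Real.exp_neg (Real.log n), Real.exp_log hn0]
    field_simp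
  refine ⟨mul_nonneg (by positivity) (pow_nonneg (by linarith) _), ?_⟩
  rw [hnq]
  have h1 : (1 - q)^(n-1) ≤ Real.exp (-(Real.exp (-x) / 2)) := by
    calc (1 - q)^(n-1) ≤ (Real.exp (-q))^(n-1) := pow_le_pow_left₀ (by linarith) (Real.one_sub_le_exp_neg q) _
      _ = Real.exp (((n-1 : ℕ):ℝ) * -q) := by rw [Real.exp_nat_mul]
      _ ≤ _ := by
        apply Real.exp_le_exp.mpr
        rw [← hnq, Nat.cast_sub (by omega)]
        push_cast
        nlinarith
  set z := Real.exp (-x) with hz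
  have hz0 : 0 < z := Real.exp_pos _
  have h2 : z * (1 - q)^(n-1) ≤ z * Real.exp (-(z/2)) := mul_le_mul_of_nonneg_left h1 hz0.le
  refine h2.trans ?_
  rcases le_total 0 x with h | h
  · rw [abs_of_nonneg h, ← hz]
    have : Real.exp (-(z/2)) ≤ 1 := Real.exp_le_one_iff.mpr (by linarith)
    nlinarith
  · rw [abs_of_nonpos h, neg_neg]
    have e1 : Real.exp x = 1 / z := by rw [hz, Real.exp_neg]; simp
    have e2 : (z/2)^2/2 ≤ Real.exp (z/2) := by
      have := Real.quadratic_le_exp_of_nonneg (show 0 ≤ z/2 by positivity)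
      linarith
    rw [e1, Real.exp_neg, mul_one_div, le_div_iff₀ hz0, mul_assoc, mul_comm _ z, ← mul_assoc, ← div_eq_mul_inv,
      div_le_iff₀ (Real.exp_pos _)]
    nlinarith

lemma dom_bound (x : ℝ) : (1 + |x|) * Real.exp (-|x|) ≤ 6 * (1 + x^2)⁻¹ := by
  have ha := abs_nonneg x
  rw [← sq_abs x]
  set a := |x|
  have h : 1 + a + a^2/2 + a^3/6 ≤ Real.exp a := by
    have := Real.sum_le_exp_of_nonneg ha 4
    simp [Finset.sum_range_succ, Nat.factorial] at this
    linarith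
  rw [Real.exp_neg, ← div_eq_mul_inv, ← div_eq_mul_inv, div_le_div_iff₀ (Real.exp_pos _) (by positivity)]
  nlinarith [sq_nonneg a]

/-- The weighted difference on the half line. -/
noncomputable def psi (n : ℕ) (t : ℝ) : ℝ :=
  (Real.log n ^ ((1:ℝ)/4) * besF t - Real.cos (2 * Real.sqrt (Real.log n) - Real.pi / 4) / Real.sqrt Real.pi) *
    ((n:ℝ) * Real.exp (-t) * (1 - Real.exp (-t))^(n-1))

noncomputable def psiI (n : ℕ) (x : ℝ) : ℝ := (Set.Ioi (0:ℝ)).indicator (psi n) (x + Real.log n)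

lemma psiI_tendsto : Tendsto (fun n : ℕ => ∫ x, psiI n x) atTop (𝓝 0) := by
  obtain ⟨C, hC0, hC⟩ := besF_bound
  have hlog : Tendsto (fun n : ℕ => Real.log n) atTop atTop :=
    Real.tendsto_log_atTop.comp tendsto_natCast_atTop_atTop
  rw [← MeasureTheory.integral_zero ℝ ℝ (μ := MeasureTheory.volume)]
  apply MeasureTheory.tendsto_integral_filter_of_dominated_convergence
    (fun x => (8 * (C + 2) * 6) * (1 + x^2)⁻¹)
  · refine Eventually.of_forall fun n => ?_
    have hc : Continuous (psi n) := by
      unfold psi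
      have := besF_continuous
      fun_prop
    exact ((hc.measurable.indicator measurableSet_Ioi).comp (measurable_id.add_const _)).aestronglyMeasurable
  · filter_upwards [eventually_ge_atTop 2] with n hn
    refine Eventually.of_forall fun x => ?_
    unfold psiI
    by_cases hx : 0 < x + Real.log n
    · rw [Set.indicator_of_mem (Set.mem_Ioi.mpr hx)]
      obtain ⟨w0, w1⟩ := weight_bound n hn x hx
      unfold psi
      rw [norm_mul, Real.norm_eq_abs, Real.norm_eq_abs, abs_of_nonneg w0]
      have hL : 0 ≤ Real.log n := Real.log_natCast_nonneg n
      have a1 := quarter_sub (Real.log n) (x + Real.log n) hL hx.le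
      rw [show Real.log n - (x + Real.log n) = -x by ring, abs_neg] at a1
      have a2 := hC _ hx.le
      have a3 := besF_abs_le (x + Real.log n)
      have a4 : Real.log n ^ ((1:ℝ)/4) * |besF (x + Real.log n)| ≤ C + (1 + |x|) := by
        calc _ ≤ ((x + Real.log n) ^ ((1:ℝ)/4) + (1 + |x|)) * |besF (x + Real.log n)| :=
              mul_le_mul_of_nonneg_right a1 (abs_nonneg _)
          _ = (x + Real.log n) ^ ((1:ℝ)/4) * |besF (x + Real.log n)| + (1 + |x|) * |besF (x + Real.log n)| := by ring
          _ ≤ _ := add_le_add a2 (mul_le_of_le_one_right (by positivity) a3)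
      have a5 : |Real.log n ^ ((1:ℝ)/4) * besF (x + Real.log n) -
          Real.cos (2 * Real.sqrt (Real.log n) - Real.pi / 4) / Real.sqrt Real.pi| ≤ (C + 2) * (1 + |x|) := by
        refine (abs_sub _ _).trans ?_
        rw [abs_mul, abs_of_nonneg (by positivity : 0 ≤ Real.log n ^ ((1:ℝ)/4))]
        have := main_abs_le (2 * Real.sqrt (Real.log n) - Real.pi / 4)
        nlinarith [abs_nonneg x]
      calc _ ≤ ((C + 2) * (1 + |x|)) * (8 * Real.exp (-|x|)) := mul_le_mul a5 w1 w0 (by positivity)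
        _ = 8 * (C + 2) * ((1 + |x|) * Real.exp (-|x|)) := by ring
        _ ≤ 8 * (C + 2) * (6 * (1 + x^2)⁻¹) := mul_le_mul_of_nonneg_left (dom_bound x) (by positivity)
        _ = _ := by ring
    · rw [Set.indicator_of_notMem (by simpa using hx), norm_zero]
      positivity
  · exact integrable_inv_one_add_sq.const_mul _
  · refine Eventually.of_forall fun x => ?_
    have h1 := ((pointwise x).comp hlog).abs.mul_const (8 * Real.exp (-|x|))
    rw [abs_zero, zero_mul] at h1
    refine squeeze_zero_norm' ?_ h1
    filter_upwards [eventually_ge_atTop 2] with n hn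
    simp only [Function.comp]
    unfold psiI
    by_cases hx : 0 < x + Real.log n
    · rw [Set.indicator_of_mem (Set.mem_Ioi.mpr hx)]
      obtain ⟨w0, w1⟩ := weight_bound n hn x hx
      unfold psi
      rw [norm_mul, Real.norm_eq_abs, Real.norm_eq_abs, abs_of_nonneg w0]
      exact mul_le_mul_of_nonneg_left w1 (abs_nonneg _)
    · rw [Set.indicator_of_notMem (by simpa using hx), norm_zero]
      positivity

lemma psiI_integral (n : ℕ) (hn : 1 ≤ n) : ∫ x, psiI n x =
    -(Real.log n ^ ((1:ℝ)/4) * ∑ k ∈ Finset.Icc 1 n, (n.choose k : ℝ) * (-1)^k * Real.exp (-(1 / (k:ℝ)))) -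
      Real.cos (2 * Real.sqrt (Real.log n) - Real.pi / 4) / Real.sqrt Real.pi := by
  have h1 : ∫ x, psiI n x = ∫ t in Set.Ioi (0:ℝ), psi n t := by
    unfold psiI
    rw [MeasureTheory.integral_add_right_eq_self (fun t => (Set.Ioi (0:ℝ)).indicator (psi n) t),
      MeasureTheory.integral_indicator measurableSet_Ioi]
  have hw : MeasureTheory.IntegrableOn (fun t : ℝ => (n:ℝ) * Real.exp (-t) * (1 - Real.exp (-t))^(n-1)) (Set.Ioi 0) := by
    apply MeasureTheory.Integrable.of_integral_ne_zero
    rw [int_one n hn]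
    norm_num
  have hb : MeasureTheory.IntegrableOn (fun t : ℝ => besF t * ((n:ℝ) * Real.exp (-t) * (1 - Real.exp (-t))^(n-1))) (Set.Ioi 0) := by
    refine MeasureTheory.Integrable.mono hw ?_ ?_
    · apply Continuous.aestronglyMeasurable
      have := besF_continuous
      fun_prop
    · refine Eventually.of_forall fun t => ?_
      rw [norm_mul]
      exact mul_le_of_le_one_left (norm_nonneg _) (besF_abs_le t)
  rw [h1]
  have h2 : ∀ t, psi n t = Real.log n ^ ((1:ℝ)/4) * (besF t * ((n:ℝ) * Real.exp (-t) * (1 - Real.exp (-t))^(n-1))) -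
      (Real.cos (2 * Real.sqrt (Real.log n) - Real.pi / 4) / Real.sqrt Real.pi) *
      ((n:ℝ) * Real.exp (-t) * (1 - Real.exp (-t))^(n-1)) := by
    intro t; unfold psi; ring
  simp_rw [h2]
  rw [MeasureTheory.integral_sub (hb.const_mul _) (hw.const_mul _), MeasureTheory.integral_const_mul,
    MeasureTheory.integral_const_mul, int_besF, int_one n hn]
  ring


/-- As `n → ∞`,
`∑_{k=1}^{n} C(n,k)(−1)^k e^{−1/k} = −cos(2√(log n) − π/4)/(√π (log n)^{1/4}) + o((log n)^{−1/4})`. -/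
theorem differences_exp_neg_inv_asymp :
    (fun n : ℕ => (∑ k ∈ Finset.Icc 1 n,
        (n.choose k : ℝ) * (-1 : ℝ) ^ k * Real.exp (-(1 / (k : ℝ)))) -
      (-(Real.cos (2 * Real.sqrt (Real.log (n : ℝ)) - Real.pi / 4) /
          (Real.sqrt Real.pi * Real.log (n : ℝ) ^ ((1 : ℝ) / 4)))))
      =o[atTop] fun n : ℕ => Real.log (n : ℝ) ^ (-(1 : ℝ) / 4) := by
  have hlogp : ∀ᶠ n : ℕ in atTop, 0 < Real.log (n:ℝ) := by
    filter_upwards [eventually_ge_atTop 2] with n hn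
    exact Real.log_pos (by exact_mod_cast hn)
  rw [isLittleO_iff_tendsto']
  · have h := psiI_tendsto.neg
    rw [neg_zero] at h
    refine h.congr' ?_
    filter_upwards [hlogp, eventually_ge_atTop 1] with n hL hn
    rw [psiI_integral n hn, show (-(1:ℝ)/4) = -((1:ℝ)/4) by ring, Real.rpow_neg hL.le, div_inv_eq_mul]
    have hne : Real.log n ^ ((1:ℝ)/4) ≠ 0 := by positivity
    have hpi : Real.sqrt Real.pi ≠ 0 := by have := Real.pi_pos; positivity
    field_simp
    ring
  · filter_upwards [hlogp] with n hL h0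
    exact absurd h0 (by positivity)
end

section
/- Let c > 0, 0 < θ < 1, and ε > 0 be real numbers, and set C₁ := √(2π)·(1−θ)^{−1/2}·(cθ)^{1/(2(1−θ))}, C₂ := ((1−θ)/θ)·(cθ)^{1/(1−θ)}, and μ := min{θ/(2(1−θ)) − ε, 1}. Then, as z → −1⁺ with z real in (−1, 0), writing v := −log(−z), one has ∑_{n=1}^∞ e^{c n^θ}·(−z)^n = C₁·(1+z)^{(2−θ)/(2(θ−1))}·exp(C₂·v^{θ/(θ−1)})·(1 + O((1+z)^μ)). -/
open Filter Asymptotics MeasureTheory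

noncomputable def gePsi (θ s : ℝ) : ℝ := (1 + θ * s - (1 + s) ^ θ) / θ

lemma gePsi_pos {θ s : ℝ} (h0 : 0 < θ) (h1 : θ < 1) (hs : -1 ≤ s) (hs' : s ≠ 0) :
    0 < gePsi θ s := by
  unfold gePsi
  have := rpow_one_add_lt_one_add_mul_self hs hs' h0 h1
  apply div_pos _ h0
  linarith

lemma gePsi_nonneg {θ s : ℝ} (h0 : 0 < θ) (h1 : θ < 1) (hs : -1 ≤ s) : 0 ≤ gePsi θ s := by
  unfold gePsi
  have := rpow_one_add_le_one_add_mul_self hs h0.le h1.le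
  apply div_nonneg _ h0.le
  linarith

lemma gePsi_local {θ : ℝ} (h0 : 0 < θ) (h1 : θ < 1) :
    ∃ K δ : ℝ, 0 < K ∧ 0 < δ ∧ δ < 1 ∧ ∀ s, |s| ≤ δ →
      |gePsi θ s - (1 - θ) / 2 * s ^ 2| ≤ K * |s| ^ 3 ∧ (1 - θ) / 4 * s ^ 2 ≤ gePsi θ s := by
  have H := (Real.one_add_rpow_hasFPowerSeriesOnBall_zero (a := θ)).hasFPowerSeriesAt.isBigO_sub_partialSum_pow 3
  obtain ⟨K, hK, H⟩ := H.exists_pos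
  have H := H.bound
  rw [Metric.eventually_nhds_iff] at H
  obtain ⟨δ, hδ, H⟩ := H
  have hb : ∀ s : ℝ, |s| < δ → |gePsi θ s - (1 - θ) / 2 * s ^ 2| ≤ K / θ * |s| ^ 3 := by
    intro s hs
    have := H (y := s) (by simpa using hs)
    rw [FormalMultilinearSeries.partialSum] at this
    simp only [Finset.sum_range_succ, Finset.sum_range_zero, binomialSeries_apply,
      Ring.choose_eq_smul] at this
    simp [List.ofFn_succ, descPochhammer_succ_left, Polynomial.smeval_mul, Polynomial.smeval_sub] at this
    have e : gePsi θ s - (1 - θ) / 2 * s ^ 2 = - ((1 + s) ^ θ - (1 + θ * s + 2⁻¹ * (θ * (θ - 1)) * (s * s))) / θ := by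
      unfold gePsi
      field_simp
      ring
    rw [e, abs_div, abs_neg, abs_of_pos h0, div_mul_eq_mul_div, div_le_div_iff_of_pos_right h0]
    exact this
  have hK' : 0 < K / θ := by positivity
  refine ⟨K / θ, min (δ / 2) (min (1 / 2) ((1 - θ) / 4 / (K / θ))), hK', ?_, ?_, ?_⟩
  · have : 0 < 1 - θ := by linarith
    positivity
  · exact lt_of_le_of_lt ((min_le_right _ _).trans (min_le_left _ _)) (by norm_num)
  · intro s hs
    have hs1 : |s| < δ := by
      have := hs.trans (min_le_left _ _)
      linarith
    have hs2 := hs.trans ((min_le_right _ _).trans (min_le_right _ _))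
    have h3 := hb s hs1
    refine ⟨h3, ?_⟩
    rw [le_div_iff₀ hK'] at hs2
    have h4 := (abs_le.1 h3).1
    have h5 : K / θ * |s| ^ 3 ≤ (1 - θ) / 4 * s ^ 2 := by
      have : K / θ * |s| ^ 3 = (|s| * (K / θ)) * s ^ 2 := by
        rw [← sq_abs s]; ring
      rw [this]
      gcongr
    linarith

lemma gePsi_far {θ δ : ℝ} (h0 : 0 < θ) (h1 : θ < 1) (hδ : 0 < δ) (hδ1 : δ < 1) :
    ∃ m : ℝ, 0 < m ∧ ∀ s, -1 ≤ s → δ ≤ |s| → m * |s| ≤ gePsi θ s := by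
  have key : ∀ s, -1 ≤ s → ∀ r, 0 ≤ r → r ≤ 1 → gePsi θ (r * s) ≤ r * gePsi θ s := by
    intro s hs r hr hr1
    have hc := (Real.concaveOn_rpow h0.le h1.le).2 (x := 1 + s) (y := 1) (by simp; linarith) (by simp)
      hr (sub_nonneg.2 hr1) (by ring)
    simp at hc
    have e : r * (1 + s) + (1 - r) = 1 + r * s := by ring
    rw [e] at hc
    unfold gePsi
    rw [mul_div_assoc', div_le_div_iff_of_pos_right h0]
    nlinarith
  have p1 := gePsi_pos h0 h1 (s := δ) (by linarith) hδ.ne'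
  have p2 := gePsi_pos h0 h1 (s := -δ) (by linarith) (by linarith)
  refine ⟨min (gePsi θ δ) (gePsi θ (-δ)) / δ, by positivity, ?_⟩
  intro s hs hs'
  have hsp : 0 < |s| := by linarith
  have k := key s hs (δ / |s|) (by positivity) (by rw [div_le_one hsp]; exact hs')
  have : min (gePsi θ δ) (gePsi θ (-δ)) ≤ gePsi θ (δ / |s| * s) := by
    rcases abs_cases s with ⟨h, h'⟩ | ⟨h, h'⟩
    · rw [h, div_mul_cancel₀]
      · exact min_le_left _ _
      · intro h; simp [h] at hsp
    · rw [h, div_neg, neg_mul, div_mul_cancel₀]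
      · exact min_le_right _ _
      · intro h; simp [h] at hsp
  have k2 := this.trans k
  rw [div_mul_eq_mul_div, div_le_iff₀ hδ]
  rw [div_mul_eq_mul_div, le_div_iff₀ hsp] at k2
  linarith


lemma ge_sum_int (f W : ℝ → ℝ) (B : ℝ) (hf : Continuous f) (hpos : ∀ x, 0 ≤ f x)
    (hint : IntegrableOn f (Set.Ioi 0))
    (hW : ∀ x y, 0 ≤ y → y ≤ x → |f x - f y| ≤ W x - W y) (hB : ∀ x, 0 ≤ x → W x - W 0 ≤ B) :
    |(∑' n : ℕ, f ((n : ℝ) + 1)) - ∫ x in Set.Ioi 0, f x| ≤ B := by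
  have h1 : ∀ N : ℕ, |(∑ n ∈ Finset.range N, f ((n : ℝ) + 1)) - ∫ x in (0:ℝ)..N, f x| ≤ W N - W 0 := by
    intro N
    induction N with
    | zero => simp
    | succ N ih =>
      have hstep : |f ((N : ℝ) + 1) - ∫ x in (N:ℝ)..((N:ℝ)+1), f x| ≤ W ((N:ℝ)+1) - W N := by
        have e : f ((N : ℝ) + 1) - ∫ x in (N:ℝ)..((N:ℝ)+1), f x
            = ∫ x in (N:ℝ)..((N:ℝ)+1), (f ((N : ℝ) + 1) - f x) := by
          rw [intervalIntegral.integral_sub (by simp) (hf.intervalIntegrable _ _)]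
          simp
        rw [e, ← Real.norm_eq_abs]
        have := intervalIntegral.norm_integral_le_of_norm_le_const (a := (N:ℝ)) (b := (N:ℝ)+1)
          (f := fun x => f ((N : ℝ) + 1) - f x) (C := W ((N:ℝ)+1) - W N) ?_
        · simpa using this
        · intro x hx
          rw [Set.uIoc_of_le (by linarith)] at hx
          have hN : (0:ℝ) ≤ N := Nat.cast_nonneg N
          have a1 := hW ((N:ℝ)+1) x (by linarith [hx.1]) hx.2
          have a2 := hW x N hN hx.1.le
          have a3 := abs_nonneg (f x - f N)
          rw [Real.norm_eq_abs]
          linarith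
      rw [Finset.sum_range_succ]
      push_cast
      rw [← intervalIntegral.integral_add_adjacent_intervals (hf.intervalIntegrable 0 (N:ℝ)) (hf.intervalIntegrable (N:ℝ) ((N:ℝ)+1))]
      rw [abs_le] at *
      constructor <;> linarith [ih.1, ih.2, hstep.1, hstep.2]
  have hlim := intervalIntegral_tendsto_integral_Ioi 0 hint (tendsto_natCast_atTop_atTop (R := ℝ))
  have hsum : Summable (fun n : ℕ => f ((n : ℝ) + 1)) := by
    apply summable_of_sum_range_le (c := (∫ x in Set.Ioi 0, f x) + B) (fun n => hpos _)
    intro N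
    have a := (abs_le.1 (h1 N)).2
    have b := hB N (Nat.cast_nonneg N)
    have d : ∫ x in (0:ℝ)..N, f x ≤ ∫ x in Set.Ioi 0, f x := by
      rw [intervalIntegral.integral_of_le (Nat.cast_nonneg N)]
      exact setIntegral_mono_set hint (ae_of_all _ hpos) (ae_of_all _ (fun x hx => hx.1))
    linarith
  have hl := (hsum.hasSum.tendsto_sum_nat.sub hlim).abs
  exact le_of_tendsto' hl (fun N => (h1 N).trans (hB N (Nat.cast_nonneg N)))

lemma ge_sum_int_unimodal (h : ℝ → ℝ) (p : ℝ) (hp : 0 ≤ p) (hh : Continuous h)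
    (hcon : ConcaveOn ℝ (Set.Ici 0) h) (hmax : ∀ x, 0 ≤ x → h x ≤ h p)
    (hint : IntegrableOn (fun x => Real.exp (h x)) (Set.Ioi 0)) :
    |(∑' n : ℕ, Real.exp (h ((n : ℝ) + 1))) - ∫ x in Set.Ioi 0, Real.exp (h x)|
      ≤ 2 * Real.exp (h p) := by
  have mono : ∀ x y, 0 ≤ y → y ≤ x → x ≤ p → h y ≤ h x := by
    intro x y hy hyx hxp
    have := hcon.min_le_of_mem_Icc (x := y) (y := p) (z := x) hy hp ⟨hyx, hxp⟩
    rwa [min_eq_left (hmax y hy)] at this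
  have anti : ∀ x y, p ≤ y → y ≤ x → h x ≤ h y := by
    intro x y hy hyx
    have := hcon.min_le_of_mem_Icc (x := p) (y := x) (z := y) hp (hp.trans (hy.trans hyx)) ⟨hy, hyx⟩
    rwa [min_eq_right (hmax x (hp.trans (hy.trans hyx)))] at this
  apply ge_sum_int (fun x => Real.exp (h x))
    (fun x => Real.exp (h (min x p)) - Real.exp (h (max x p))) _ (by fun_prop)
    (fun x => (Real.exp_pos _).le) hint
  · intro x y hy hyx
    have hx := hy.trans hyx
    rcases le_total x p with hxp | hxp
    · rw [min_eq_left hxp, max_eq_right hxp, min_eq_left (hyx.trans hxp), max_eq_right (hyx.trans hxp)]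
      have := Real.exp_le_exp.2 (mono x y hy hyx hxp)
      rw [abs_of_nonneg] <;> linarith
    · rcases le_total y p with hyp | hyp
      · rw [min_eq_right hxp, max_eq_left hxp, min_eq_left hyp, max_eq_right hyp]
        have a1 := Real.exp_le_exp.2 (hmax x hx)
        have a2 := Real.exp_le_exp.2 (hmax y hy)
        rw [abs_le]; constructor <;> linarith
      · rw [min_eq_right hxp, max_eq_left hxp, min_eq_right hyp, max_eq_left hyp]
        have := Real.exp_le_exp.2 (anti x y hyp hyx)
        rw [abs_le]; constructor <;> linarith
  · intro x hx
    rw [min_eq_left hp, max_eq_right hp]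
    have a1 := Real.exp_le_exp.2 (hmax (min x p) (le_min hx hp))
    have a2 := Real.exp_pos (h (max x p))
    have a3 := Real.exp_pos (h 0)
    show Real.exp (h (min x p)) - Real.exp (h (max x p)) - _ ≤ _
    linarith

lemma ge_exp_abs {m : ℝ} (hm : 0 < m) :
    Integrable (fun s : ℝ => Real.exp (-m * |s|)) ∧ ∫ s : ℝ, Real.exp (-m * |s|) = 2 / m := by
  have : ∫ s : ℝ, Real.exp (-m * |s|) = 2 / m := by
    rw [integral_comp_abs (f := fun x => Real.exp (-m * x)), integral_exp_mul_Ioi (by linarith)]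
    simp
    field_simp
  refine ⟨?_, this⟩
  apply Integrable.of_integral_ne_zero
  rw [this]
  positivity

lemma ge_gauss_abs {m : ℝ} (hm : 0 < m) :
    Integrable (fun s : ℝ => |s| * Real.exp (-m * |s| ^ 2)) ∧
      ∫ s : ℝ, |s| * Real.exp (-m * |s| ^ 2) = 1 / m := by
  have : ∫ s : ℝ, |s| * Real.exp (-m * |s| ^ 2) = 1 / m := by
    rw [integral_comp_abs (f := fun x => x * Real.exp (-m * x ^ 2))]
    have := integral_rpow_mul_exp_neg_mul_rpow (p := 2) (q := 1) (b := m) (by norm_num) (by norm_num) hm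
    norm_num [Real.rpow_neg_one] at this
    simp only [neg_mul]
    rw [this]
    field_simp
  refine ⟨?_, this⟩
  apply Integrable.of_integral_ne_zero
  rw [this]
  positivity

lemma ge_exp_diff {x y z : ℝ} (hx : z ≤ x) (hy : z ≤ y) :
    |Real.exp (-x) - Real.exp (-y)| ≤ |x - y| * Real.exp (-z) := by
  wlog h : x ≤ y generalizing x y
  · rw [abs_sub_comm, abs_sub_comm x]
    exact this hy hx (le_of_not_ge h)
  have h1 : Real.exp (-y) ≤ Real.exp (-x) := Real.exp_le_exp.2 (by linarith)
  have h2 : Real.exp (-x) ≤ Real.exp (-z) := Real.exp_le_exp.2 (by linarith)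
  rw [abs_of_nonneg (by linarith), abs_of_nonpos (by linarith)]
  have e : Real.exp (-y) = Real.exp (-x) * Real.exp (x - y) := by rw [← Real.exp_add]; ring_nf
  have h3 := Real.add_one_le_exp (x - y)
  have h4 := Real.exp_pos (-x)
  rw [e]
  calc _ = Real.exp (-x) * (1 - Real.exp (x - y)) := by ring
    _ ≤ Real.exp (-x) * (y - x) := mul_le_mul_of_nonneg_left (by linarith) h4.le
    _ ≤ Real.exp (-z) * (y - x) := mul_le_mul_of_nonneg_right h2 (by linarith)
    _ = _ := by ring

lemma ge_laplace {θ : ℝ} (h0 : 0 < θ) (h1 : θ < 1) :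
    ∃ K : ℝ, 0 < K ∧ ∀ l : ℝ, 0 < l →
      Integrable ((Set.Ioi (-1)).indicator (fun s => Real.exp (-(l * gePsi θ s)))) ∧
      |(∫ s, (Set.Ioi (-1)).indicator (fun s => Real.exp (-(l * gePsi θ s))) s) -
        √(Real.pi / (l * ((1 - θ) / 2)))| ≤ K / l := by
  obtain ⟨K, δ, hK, hδ, hδ1, hloc⟩ := gePsi_local h0 h1
  obtain ⟨m, hm, hfar⟩ := gePsi_far h0 h1 hδ hδ1
  obtain ⟨b, hb⟩ : ∃ b, b = (1 - θ) / 4 := ⟨_, rfl⟩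
  have ha : (1 - θ) / 2 = 2 * b := by rw [hb]; ring
  rw [← hb, ha] at hloc
  rw [ha]
  have hb0 : 0 < b := by rw [hb]; linarith
  refine ⟨K * (2 / b) * (2 / b) + 2 / m + 2 / (2 * b * δ), by positivity, ?_⟩
  intro l hl
  obtain ⟨i1, e1⟩ := ge_gauss_abs (m := l * b / 2) (by positivity)
  obtain ⟨i2, e2⟩ := ge_exp_abs (m := l * m) (by positivity)
  obtain ⟨i3, e3⟩ := ge_exp_abs (m := l * (2 * b * δ)) (by positivity)
  have iD := ((i1.const_mul (K * (2 / b))).add i2).add i3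
  have iG := integrable_exp_neg_mul_sq (b := l * (2 * b)) (by positivity)
  have eG := integral_gaussian (l * (2 * b))
  set F := (Set.Ioi (-1:ℝ)).indicator (fun s => Real.exp (-(l * gePsi θ s))) with hF
  have hmeas : Measurable F := by
    apply Measurable.indicator _ measurableSet_Ioi
    unfold gePsi
    fun_prop
  have hdom : ∀ s, ‖F s - Real.exp (-(l * (2 * b)) * s ^ 2)‖ ≤
      K * (2 / b) * (|s| * Real.exp (-(l * b / 2) * |s| ^ 2)) + Real.exp (-(l * m) * |s|)
        + Real.exp (-(l * (2 * b * δ)) * |s|) := by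
    intro s
    rw [Real.norm_eq_abs]
    have p2 := Real.exp_pos (-(l * m) * |s|)
    have p3 := Real.exp_pos (-(l * (2 * b * δ)) * |s|)
    have p1 : 0 ≤ K * (2 / b) * (|s| * Real.exp (-(l * b / 2) * |s| ^ 2)) := by positivity
    rcases le_or_gt |s| δ with hs | hs
    · have hs1 : s ∈ Set.Ioi (-1:ℝ) := by
        have := (abs_le.1 hs).1
        simp; linarith
      rw [hF, Set.indicator_of_mem hs1]
      obtain ⟨q1, q2⟩ := hloc s hs
      have d := ge_exp_diff (x := l * gePsi θ s) (y := l * (2 * b) * s ^ 2) (z := l * (b * s ^ 2))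
        (by gcongr) (by nlinarith [mul_nonneg (mul_nonneg hl.le hb0.le) (sq_nonneg s)])
      have d2 : |l * gePsi θ s - l * (2 * b) * s ^ 2| ≤ l * (K * |s| ^ 3) := by
        rw [mul_assoc l, ← mul_sub, abs_mul, abs_of_pos hl]
        gcongr
      have d3 : l * b / 2 * s ^ 2 * Real.exp (-(l * b / 2 * s ^ 2)) ≤ 1 := by
        rw [Real.exp_neg, ← div_eq_mul_inv, div_le_one (Real.exp_pos _)]
        linarith [Real.add_one_le_exp (l * b / 2 * s ^ 2)]
      have d4 : l * (K * |s| ^ 3) * Real.exp (-(l * (b * s ^ 2))) =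
          K * (2 / b) * (|s| * Real.exp (-(l * b / 2) * |s| ^ 2)) *
            (l * b / 2 * s ^ 2 * Real.exp (-(l * b / 2 * s ^ 2))) := by
        have : Real.exp (-(l * (b * s ^ 2))) =
          Real.exp (-(l * b / 2) * |s| ^ 2) * Real.exp (-(l * b / 2 * s ^ 2)) := by
          rw [← Real.exp_add, sq_abs]; ring_nf
        rw [this, ← sq_abs s]
        field_simp
      rw [neg_mul (l * (2 * b))]
      calc _ ≤ _ := d
        _ ≤ l * (K * |s| ^ 3) * Real.exp (-(l * (b * s ^ 2))) := by gcongr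
        _ ≤ K * (2 / b) * (|s| * Real.exp (-(l * b / 2) * |s| ^ 2)) * 1 := by
          rw [d4]; gcongr
        _ ≤ _ := by linarith
    · have f1 : F s ≤ Real.exp (-(l * m) * |s|) := by
        by_cases hs1 : s ∈ Set.Ioi (-1:ℝ)
        · rw [hF, Set.indicator_of_mem hs1]
          apply Real.exp_le_exp.2
          have := hfar s (le_of_lt hs1) hs.le
          nlinarith
        · rw [hF, Set.indicator_of_notMem hs1]; exact p2.le
      have f0 : 0 ≤ F s := Set.indicator_nonneg (fun _ _ => (Real.exp_pos _).le) s
      have g1 : Real.exp (-(l * (2 * b)) * s ^ 2) ≤ Real.exp (-(l * (2 * b * δ)) * |s|) := by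
        apply Real.exp_le_exp.2
        rw [← sq_abs s]
        have : δ * |s| ≤ |s| ^ 2 := by nlinarith [abs_nonneg s]
        have h3 : 0 < l * (2 * b) := by positivity
        nlinarith
      have g0 := Real.exp_pos (-(l * (2 * b)) * s ^ 2)
      rw [abs_le]; constructor <;> linarith
  have iFG : Integrable (fun s => F s - Real.exp (-(l * (2 * b)) * s ^ 2)) :=
    iD.mono' (hmeas.sub (by fun_prop)).aestronglyMeasurable (ae_of_all _ hdom)
  have iF : Integrable F := by
    have := iFG.add iG
    refine this.congr (ae_of_all _ fun s => ?_)
    simp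
  refine ⟨iF, ?_⟩
  rw [← eG, ← integral_sub iF iG, ← Real.norm_eq_abs]
  calc _ ≤ _ := norm_integral_le_of_norm_le iD (ae_of_all _ hdom)
    _ = _ := by
      rw [integral_add' ((i1.const_mul (K * (2 / b))).add i2) i3,
        integral_add' (i1.const_mul (K * (2 / b))) i2, integral_const_mul, e1, e2, e3]
      field_simp

lemma ge_main {c θ : ℝ} (hc : 0 < c) (h0 : 0 < θ) (h1 : θ < 1) :
    ∃ K : ℝ, 0 < K ∧ ∀ v p : ℝ, 0 < v → 0 < p → c * p ^ θ = p * v / θ →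
      |(∑' n : ℕ, Real.exp (c * ((n : ℝ) + 1) ^ θ - v * ((n : ℝ) + 1))) -
        Real.exp (p * v * ((1 - θ) / θ)) * p * √(Real.pi / (p * v * ((1 - θ) / 2)))|
      ≤ Real.exp (p * v * ((1 - θ) / θ)) * (2 + p * (K / (p * v))) := by
  obtain ⟨K, hK, H⟩ := ge_laplace h0 h1
  refine ⟨K, hK, ?_⟩
  intro v p hv hp hpv
  obtain ⟨iF, eF⟩ := H (p * v) (by positivity)
  set M := Real.exp (p * v * ((1 - θ) / θ)) with hM
  have hM0 : 0 < M := Real.exp_pos _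
  set F := (Set.Ioi (-1:ℝ)).indicator (fun s => Real.exp (-(p * v * gePsi θ s))) with hF
  obtain ⟨h, hh⟩ : ∃ h : ℝ → ℝ, h = fun x => c * x ^ θ - v * x := ⟨_, rfl⟩
  have hval : ∀ s, -1 ≤ s → h (p * (1 + s)) = p * v * ((1 - θ) / θ) - p * v * gePsi θ s := by
    intro s hs
    rw [hh]
    simp only
    rw [Real.mul_rpow hp.le (by linarith), ← mul_assoc, hpv]
    unfold gePsi
    field_simp
    ring
  have hp1 : h p = p * v * ((1 - θ) / θ) := by
    have := hval 0 (by norm_num)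
    simpa [gePsi] using this
  have hmax : ∀ x, 0 ≤ x → h x ≤ h p := by
    intro x hx
    have hs : -1 ≤ x / p - 1 := by
      have : 0 ≤ x / p := by positivity
      linarith
    have := hval (x / p - 1) hs
    have e : p * (1 + (x / p - 1)) = x := by field_simp; ring
    rw [e] at this
    rw [this, hp1]
    have := gePsi_nonneg h0 h1 hs
    have : 0 ≤ p * v * gePsi θ (x / p - 1) := by positivity
    linarith
  have hcont : Continuous h := by
    rw [hh]
    have := Real.continuous_rpow_const h0.le
    fun_prop
  have hconc : ConcaveOn ℝ (Set.Ici 0) h := by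
    rw [hh]
    refine ((Real.concaveOn_rpow h0.le h1.le).smul hc.le).sub ?_
    exact (LinearMap.convexOn (LinearMap.mulLeft ℝ v) (convex_Ici 0))
  set G := (Set.Ioi (0:ℝ)).indicator (fun x => Real.exp (h x)) with hG
  have hGF : ∀ s, G (p * (1 + s)) = M * F s := by
    intro s
    by_cases hs : -1 < s
    · have m1 : p * (1 + s) ∈ Set.Ioi (0:ℝ) := by
        have : 0 < 1 + s := by linarith
        simp only [Set.mem_Ioi]; positivity
      rw [hG, hF, Set.indicator_of_mem m1, Set.indicator_of_mem (show s ∈ Set.Ioi (-1:ℝ) from hs),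
        hval s hs.le, hM, ← Real.exp_add, sub_eq_add_neg]
    · have m1 : p * (1 + s) ∉ Set.Ioi (0:ℝ) := by
        have : 1 + s ≤ 0 := by linarith
        simp only [Set.mem_Ioi, not_lt]
        exact mul_nonpos_of_nonneg_of_nonpos hp.le this
      rw [hG, hF, Set.indicator_of_notMem m1, Set.indicator_of_notMem (show s ∉ Set.Ioi (-1:ℝ) from hs)]
      simp
  have iG1 : Integrable (fun s => G (p * (1 + s))) := by
    simp_rw [hGF]
    exact iF.const_mul M
  have iG2 : Integrable (fun y => G (p * y)) := by
    have := iG1.comp_add_left (-1)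
    simpa using this
  have iG : Integrable G := (integrable_comp_mul_left_iff G hp.ne').1 iG2
  have eG : ∫ x, G x = M * p * ∫ s, F s := by
    have a1 := Measure.integral_comp_mul_left G p
    have a2 := integral_add_left_eq_self (μ := volume) (fun y => G (p * y)) 1
    simp_rw [hGF] at a2
    rw [integral_const_mul, a1, abs_of_pos (inv_pos.2 hp), smul_eq_mul] at a2
    field_simp at a2
    linarith
  have hint : IntegrableOn (fun x => Real.exp (h x)) (Set.Ioi 0) :=
    (integrable_indicator_iff measurableSet_Ioi).1 iG
  have S := ge_sum_int_unimodal h p hp.le hcont hconc hmax hint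
  rw [← integral_indicator measurableSet_Ioi, ← hG, eG, hp1, ← hM] at S
  rw [hh] at S
  simp only at S
  have T : |M * p * ((∫ s, F s) - √(Real.pi / (p * v * ((1 - θ) / 2))))| ≤ M * p * (K / (p * v)) := by
    rw [abs_mul, abs_of_pos (by positivity)]
    gcongr
  rw [abs_le] at *
  constructor <;> linarith [S.1, S.2, T.1, T.2]

lemma ge_rel {c θ C₁ C₂ : ℝ} (hc : 0 < c) (h0 : 0 < θ) (h1 : θ < 1)
    (hC₁ : C₁ = Real.sqrt (2 * Real.pi) * (1 - θ) ^ (-(1 : ℝ) / 2) *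
      (c * θ) ^ (1 / (2 * (1 - θ))))
    (hC₂ : C₂ = ((1 - θ) / θ) * (c * θ) ^ (1 / (1 - θ))) :
    ∃ K : ℝ, 0 < K ∧ ∀ v : ℝ, 0 < v → v ≤ 1 →
      |(∑' n : ℕ, Real.exp (c * ((n : ℝ) + 1) ^ θ - v * ((n : ℝ) + 1))) /
        (C₁ * v ^ ((2 - θ) / (2 * (θ - 1))) * Real.exp (C₂ * v ^ (θ / (θ - 1)))) - 1|
      ≤ K * v ^ (θ / (2 * (1 - θ))) := by
  obtain ⟨K, hK, H⟩ := ge_main hc h0 h1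
  have ht : 0 < 1 - θ := by linarith
  have ht' : θ - 1 ≠ 0 := by linarith
  have hcθ : 0 < c * θ := by positivity
  have hC₁0 : 0 < C₁ := by rw [hC₁]; positivity
  refine ⟨(2 + K) / C₁, by positivity, ?_⟩
  intro v hv hv1
  set A := (c * θ) ^ (1 / (1 - θ)) with hA
  have hA0 : 0 < A := by positivity
  obtain ⟨p, hp⟩ : ∃ p, p = A * v ^ (1 / (θ - 1)) := ⟨_, rfl⟩
  have hp0 : 0 < p := by rw [hp]; positivity
  have hpv : p * v = A * v ^ (θ / (θ - 1)) := by
    rw [hp, mul_assoc]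
    nth_rewrite 2 [← Real.rpow_one v]
    rw [← Real.rpow_add hv]
    congr 2
    field_simp
    ring
  have hsad : c * p ^ θ = p * v / θ := by
    rw [hpv, hp, Real.mul_rpow hA0.le (by positivity), ← Real.rpow_mul hv.le, hA,
      ← Real.rpow_mul hcθ.le]
    have e1 : 1 / (θ - 1) * θ = θ / (θ - 1) := by ring
    have e2 : (c * θ) ^ (1 / (1 - θ)) = (c * θ) ^ (1 / (1 - θ) * θ) * (c * θ) := by
      nth_rewrite 3 [← Real.rpow_one (c * θ)]
      rw [← Real.rpow_add hcθ]
      congr 1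
      field_simp
      ring
    rw [e1, e2]
    field_simp
  have hH := H v p hv hp0 hsad
  have hM : Real.exp (p * v * ((1 - θ) / θ)) = Real.exp (C₂ * v ^ (θ / (θ - 1))) := by
    rw [hpv, hC₂]; congr 1; ring
  have hT : p * √(Real.pi / (p * v * ((1 - θ) / 2))) = C₁ * v ^ ((2 - θ) / (2 * (θ - 1))) := by
    apply (sq_eq_sq₀ (by positivity) (by positivity)).1
    have sq_r : ∀ x : ℝ, 0 < x → ∀ y : ℝ, (x ^ y) ^ 2 = x ^ (y * ((2 : ℕ) : ℝ)) := by
      intro x hx y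
      rw [Real.rpow_mul hx.le, Real.rpow_natCast]
    rw [mul_pow, mul_pow, Real.sq_sqrt (by positivity), hC₁, mul_pow, mul_pow,
      Real.sq_sqrt (by positivity), sq_r _ ht, sq_r _ hcθ, sq_r _ hv]
    have e1 : (c * θ) ^ (1 / (2 * (1 - θ)) * ((2 : ℕ) : ℝ)) = A := by
      rw [hA]; congr 1; push_cast; field_simp
    have e2 : (1 - θ) ^ (-(1:ℝ) / 2 * ((2 : ℕ) : ℝ)) = (1 - θ)⁻¹ := by
      rw [← Real.rpow_neg_one]; congr 1; push_cast; norm_num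
    have e3 : v ^ ((2 - θ) / (2 * (θ - 1)) * ((2 : ℕ) : ℝ)) = v ^ (1 / (θ - 1)) / v := by
      nth_rewrite 3 [← Real.rpow_one v]
      rw [← Real.rpow_sub hv]
      congr 1; push_cast; field_simp; ring
    rw [e1, e2, e3]
    have e4 : v ^ (1 / (θ - 1)) = p / A := by rw [hp]; field_simp
    rw [e4]
    field_simp
  rw [hM, mul_assoc, hT, mul_comm _ (C₁ * _)] at hH
  set S := ∑' n : ℕ, Real.exp (c * ((n : ℝ) + 1) ^ θ - v * ((n : ℝ) + 1))
  set E := Real.exp (C₂ * v ^ (θ / (θ - 1)))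
  have hE : 0 < E := Real.exp_pos _
  set Q := v ^ ((2 - θ) / (2 * (θ - 1))) with hQ
  have hQ0 : 0 < Q := by positivity
  have hκ : v ^ (θ / (2 * (1 - θ))) = 1 / (v * Q) := by
    rw [hQ]
    nth_rewrite 2 [← Real.rpow_one v]
    rw [← Real.rpow_add hv, one_div, ← Real.rpow_neg hv.le]
    congr 1
    have : 2 * (1 - θ) ≠ 0 := by positivity
    have e : (2 - θ) / (2 * (θ - 1)) = - ((2 - θ) / (2 * (1 - θ))) := by
      rw [← div_neg]; congr 1; ring
    rw [e]
    field_simp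
    ring
  have hden : 0 < C₁ * Q * E := by positivity
  have e : S / (C₁ * Q * E) - 1 = (S - C₁ * Q * E) / (C₁ * Q * E) := by field_simp
  rw [e, abs_div, abs_of_pos hden, div_le_iff₀ hden, hκ]
  have e5 : (2 + K) / C₁ * (1 / (v * Q)) * (C₁ * Q * E) = (2 + K) / v * E := by
    field_simp
  rw [e5]
  refine hH.trans ?_
  have e6 : p * (K / (p * v)) = K / v := by field_simp
  rw [e6, add_div, mul_comm E]
  have : 2 ≤ 2 / v := by rw [le_div_iff₀ hv]; linarith
  gcongr

/-- Let `c > 0`, `0 < θ < 1`, `ε > 0`, and set `C₁ = √(2π)(1−θ)^{−1/2}(cθ)^{1/(2(1−θ))}`,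
`C₂ = ((1−θ)/θ)(cθ)^{1/(1−θ)}`, and `μ = min{θ/(2(1−θ)) − ε, 1}`.  Then, as `z → −1⁺`
with `z ∈ (−1, 0)` real, writing `v = −log(−z)`,
`∑_{n≥1} e^{c n^θ}(−z)^n = C₁ (1+z)^{(2−θ)/(2(θ−1))} exp(C₂ v^{θ/(θ−1)}) (1 + O((1+z)^μ))`. -/
theorem genExp_at_minus_one_c_pos
    (c θ ε : ℝ) (hc : 0 < c) (hθ0 : 0 < θ) (hθ1 : θ < 1) (hε : 0 < ε)
    (C₁ C₂ μ : ℝ)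
    (hC₁ : C₁ = Real.sqrt (2 * Real.pi) * (1 - θ) ^ (-(1 : ℝ) / 2) *
      (c * θ) ^ (1 / (2 * (1 - θ))))
    (hC₂ : C₂ = ((1 - θ) / θ) * (c * θ) ^ (1 / (1 - θ)))
    (hμ : μ = min (θ / (2 * (1 - θ)) - ε) 1) :
    (fun z : ℝ =>
        (∑' n : ℕ, Real.exp (c * ((n : ℝ) + 1) ^ θ) * (-z) ^ (n + 1)) /
          (C₁ * (1 + z) ^ ((2 - θ) / (2 * (θ - 1))) *
            Real.exp (C₂ * (-Real.log (-z)) ^ (θ / (θ - 1)))) - 1)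
      =O[nhdsWithin (-1 : ℝ) (Set.Ioo (-1) 0)] fun z : ℝ => (1 + z) ^ μ := by
  obtain ⟨K, hK, H⟩ := ge_rel hc hθ0 hθ1 hC₁ hC₂
  have ht : 0 < 1 - θ := by linarith
  have hC₁0 : 0 < C₁ := by rw [hC₁]; positivity
  obtain ⟨q, hq⟩ : ∃ q, q = (2 - θ) / (2 * (θ - 1)) := ⟨_, rfl⟩
  obtain ⟨κ, hκ⟩ : ∃ κ, κ = θ / (2 * (1 - θ)) := ⟨_, rfl⟩
  rw [← hq, ← hκ] at H
  rw [← hq]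
  rw [← hκ] at hμ
  have hq0 : q < 0 := by
    rw [hq]; apply div_neg_of_pos_of_neg <;> linarith
  have hκ0 : 0 < κ := by rw [hκ]; positivity
  have hμκ : μ ≤ κ := by rw [hμ]; exact (min_le_left _ _).trans (by linarith)
  have hμ1 : μ ≤ 1 := by rw [hμ]; exact min_le_right _ _
  apply IsBigO.of_bound (K * 2 ^ κ + 2 * (-q))
  have hev : ∀ᶠ z in nhdsWithin (-1 : ℝ) (Set.Ioo (-1) 0), z < -1/2 :=
    nhdsWithin_le_nhds (Iio_mem_nhds (by norm_num))
  filter_upwards [hev, self_mem_nhdsWithin] with z hz1 hz2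
  obtain ⟨w, hw⟩ : ∃ w, w = 1 + z := ⟨_, rfl⟩
  have hw0 : 0 < w := by rw [hw]; linarith [hz2.1]
  have hwh : w ≤ 1 / 2 := by rw [hw]; linarith
  obtain ⟨v, hv⟩ : ∃ v, v = -Real.log (-z) := ⟨_, rfl⟩
  have hzv : -z = Real.exp (-v) := by rw [hv, neg_neg, Real.exp_log (by linarith)]
  rw [← hw, ← hv, hzv]
  have hS : ∀ n : ℕ, Real.exp (c * ((n : ℝ) + 1) ^ θ) * Real.exp (-v) ^ (n + 1) =
      Real.exp (c * ((n : ℝ) + 1) ^ θ - v * ((n : ℝ) + 1)) := by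
    intro n
    rw [← Real.exp_nat_mul, ← Real.exp_add]; congr 1; push_cast; ring
  simp_rw [hS]
  have hwv : w ≤ v := by
    have := Real.log_le_sub_one_of_pos (x := -z) (by linarith)
    rw [hv, hw]; linarith
  have hvw : v ≤ w + 2 * w ^ 2 := by
    have := Real.one_sub_inv_le_log_of_pos (x := -z) (by linarith)
    have e : -z = 1 - w := by rw [hw]; ring
    rw [hv]
    rw [e] at this ⊢
    have h2 : (1 - w)⁻¹ ≤ 1 + w + 2 * w ^ 2 := by
      rw [inv_le_iff_one_le_mul₀ (by linarith)]
      nlinarith [sq_nonneg w, mul_nonneg (sq_nonneg w) (by linarith : 0 ≤ 1 - 2 * w)]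
    linarith
  have hv0 : 0 < v := by linarith
  have hv2 : v ≤ 2 * w := by nlinarith
  have hv1 : v ≤ 1 := by linarith
  have hH := H v hv0 hv1
  set S := ∑' n : ℕ, Real.exp (c * ((n : ℝ) + 1) ^ θ - v * ((n : ℝ) + 1))
  set E := Real.exp (C₂ * v ^ (θ / (θ - 1)))
  have hE : 0 < E := Real.exp_pos _
  set r := v / w with hr
  have hr1 : 1 ≤ r := by rw [hr, le_div_iff₀ hw0]; linarith
  have hr2 : r ≤ 1 + 2 * w := by rw [hr, div_le_iff₀ hw0]; nlinarith
  have hrq1 : r ^ q ≤ 1 := Real.rpow_le_one_of_one_le_of_nonpos hr1 hq0.le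
  have hrq0 : 0 < r ^ q := by positivity
  have hrq2 : 1 + 2 * q * w ≤ r ^ q := by
    rw [Real.rpow_def_of_pos (by linarith)]
    have a1 := Real.add_one_le_exp (Real.log r * q)
    have a2 := Real.log_le_sub_one_of_pos (x := r) (by linarith)
    nlinarith
  have hvq : v ^ q = r ^ q * w ^ q := by
    rw [← Real.mul_rpow (by positivity) hw0.le, hr]; congr 1; field_simp
  have e : S / (C₁ * w ^ q * E) - 1 = (S / (C₁ * v ^ q * E) - 1) * r ^ q + (r ^ q - 1) := by
    rw [hvq]
    have : 0 < w ^ q := by positivity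
    field_simp
    ring
  have hwκ : w ^ κ ≤ w ^ μ := Real.rpow_le_rpow_of_exponent_ge hw0 (by linarith) hμκ
  have hw1 : w ≤ w ^ μ := by
    have := Real.rpow_le_rpow_of_exponent_ge hw0 (by linarith) hμ1
    rwa [Real.rpow_one] at this
  have hwμ : 0 < w ^ μ := by positivity
  have hvκ : v ^ κ ≤ 2 ^ κ * w ^ κ := by
    rw [← Real.mul_rpow (by norm_num) hw0.le]
    exact Real.rpow_le_rpow hv0.le hv2 hκ0.le
  rw [Real.norm_eq_abs, Real.norm_eq_abs, abs_of_pos hwμ, e]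
  have b1 : |(S / (C₁ * v ^ q * E) - 1) * r ^ q| ≤ K * 2 ^ κ * w ^ μ := by
    rw [abs_mul, abs_of_pos hrq0]
    calc _ ≤ (K * v ^ κ) * 1 := by gcongr
      _ = K * v ^ κ := by ring
      _ ≤ K * (2 ^ κ * w ^ μ) := by
        gcongr
        exact hvκ.trans (by gcongr)
      _ = _ := by ring
  have b2 : |r ^ q - 1| ≤ 2 * (-q) * w ^ μ := by
    rw [abs_of_nonpos (by linarith)]
    have : 2 * (-q) * w ≤ 2 * (-q) * w ^ μ := by
      apply mul_le_mul_of_nonneg_left hw1; linarith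
    linarith
  calc _ ≤ _ := abs_add_le _ _
    _ ≤ _ := add_le_add b1 b2
    _ = _ := by ring
end

section
/- For every ε > 0, as z → −1⁺ with z real in (−1, 0), ∑_{n=1}^∞ e^{√n}·(−z)^n = √π·e^{−1/8}·(1+z)^{−3/2}·exp(1/(4(1+z)))·(1 + O((1+z)^{1/2−ε})). -/
open Filter Asymptotics

namespace ExpSqrtAux

/-- the summand as a function of a real variable -/
noncomputable def f (s x : ℝ) : ℝ := Real.exp (Real.sqrt x - s * x)

noncomputable def g (s v : ℝ) : ℝ := Real.exp (v - s * v ^ 2)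

noncomputable def G (s u : ℝ) : ℝ := ∫ v in (0:ℝ)..u, g s v

noncomputable def H (s x : ℝ) : ℝ := (1 / s) * (G s (Real.sqrt x) - f s x)

lemma g_cont (s : ℝ) : Continuous (g s) := by unfold g; fun_prop

lemma f_cont (s : ℝ) : Continuous (f s) := by unfold f; fun_prop

lemma g_eq (s : ℝ) (hs : 0 < s) (v : ℝ) :
    g s v = Real.exp (1 / (4 * s)) * Real.exp (-s * (v - 1 / (2 * s)) ^ 2) := by
  unfold g
  rw [← Real.exp_add]
  congr 1
  field_simp
  ring

lemma g_int (s : ℝ) (hs : 0 < s) : MeasureTheory.Integrable (g s) := by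
  have h := ((integrable_exp_neg_mul_sq hs).comp_sub_right (1 / (2 * s))).const_mul
    (Real.exp (1 / (4 * s)))
  refine h.congr (Filter.Eventually.of_forall fun v => ?_)
  simp only [g_eq s hs v]

lemma g_integral (s : ℝ) (hs : 0 < s) :
    ∫ v, g s v = Real.exp (1 / (4 * s)) * Real.sqrt (Real.pi / s) := by
  simp_rw [g_eq s hs]
  rw [MeasureTheory.integral_const_mul,
    MeasureTheory.integral_sub_right_eq_self (fun v => Real.exp (-s * v ^ 2)) (1 / (2 * s)),
    integral_gaussian]

lemma g_left (s : ℝ) (hs : 0 < s) :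
    0 ≤ ∫ v in Set.Iic (0:ℝ), g s v ∧ ∫ v in Set.Iic (0:ℝ), g s v ≤ 1 := by
  constructor
  · exact MeasureTheory.integral_nonneg fun v => (Real.exp_pos _).le
  · rw [← integral_exp_Iic_zero]
    refine MeasureTheory.setIntegral_mono (g_int s hs).integrableOn
      (integrableOn_exp_Iic 0) fun v => ?_
    unfold g
    apply Real.exp_le_exp.2
    nlinarith [mul_nonneg hs.le (sq_nonneg v)]

lemma G_tendsto (s : ℝ) (hs : 0 < s) :
    ∃ K : ℝ, 0 ≤ K ∧ K ≤ 1 ∧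
      Tendsto (G s) atTop (nhds (Real.exp (1 / (4 * s)) * Real.sqrt (Real.pi / s) - K)) := by
  refine ⟨_, (g_left s hs).1, (g_left s hs).2, ?_⟩
  have h := MeasureTheory.intervalIntegral_tendsto_integral_Ioi (0:ℝ)
    (g_int s hs).integrableOn tendsto_id
  have h2 := intervalIntegral.integral_Iic_add_Ioi (b := (0:ℝ)) (g_int s hs).integrableOn
    (g_int s hs).integrableOn
  rw [g_integral s hs] at h2
  rw [← h2, add_sub_cancel_left]
  exact h

lemma f_tendsto (s : ℝ) (hs : 0 < s) :
    Tendsto (fun N : ℕ => f s N) atTop (nhds 0) := by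
  unfold f
  refine Real.tendsto_exp_atBot.comp ?_
  have h : Tendsto (fun N : ℕ => Real.sqrt N * (1 - s * Real.sqrt N)) atTop atBot := by
    have h1 : Tendsto (fun N : ℕ => Real.sqrt N) atTop atTop :=
      Real.tendsto_sqrt_atTop.comp tendsto_natCast_atTop_atTop
    refine h1.atTop_mul_atBot₀ ?_
    have := tendsto_neg_atTop_atBot.comp (h1.const_mul_atTop hs)
    simpa [sub_eq_add_neg] using tendsto_atBot_add_const_left _ (1:ℝ) this
  refine h.congr fun N => ?_
  have := Real.mul_self_sqrt (Nat.cast_nonneg (α := ℝ) N)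
  linear_combination -s * this

lemma H_deriv (s : ℝ) (hs : 0 < s) (x : ℝ) (hx : 0 < x) : HasDerivAt (H s) (f s x) x := by
  have h1 : HasDerivAt (G s) (g s (Real.sqrt x)) (Real.sqrt x) :=
    (g_cont s).integral_hasStrictDerivAt 0 _ |>.hasDerivAt
  have h2 := Real.hasDerivAt_sqrt hx.ne'
  have h3 := h1.comp x h2
  have h4 : HasDerivAt (f s) (f s x * (1 / (2 * Real.sqrt x) - s * 1)) x :=
    (h2.sub ((hasDerivAt_id x).const_mul s)).exp
  have h5 := (h3.sub h4).const_mul (1 / s)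
  refine h5.congr_deriv ?_
  have : g s (Real.sqrt x) = f s x := by
    unfold g f; rw [Real.sq_sqrt hx.le]
  rw [this]
  field_simp
  ring

lemma H_cont (s : ℝ) (_hs : 0 < s) : Continuous (H s) := by
  have : Continuous (G s) := by
    unfold G
    exact intervalIntegral.continuous_primitive
      (fun a b => (g_cont s).intervalIntegrable a b) 0
  unfold H
  have h2 := f_cont s
  exact continuous_const.mul ((this.comp Real.continuous_sqrt).sub h2)

/-- total variation majorant -/
noncomputable def V (s x : ℝ) : ℝ :=
  f s (min x (1 / (4 * s ^ 2))) - f s (max x (1 / (4 * s ^ 2)))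

lemma f_mono (s : ℝ) (hs : 0 < s) {x y : ℝ} (hx : 0 ≤ x) (hxy : x ≤ y)
    (hy : y ≤ 1 / (4 * s ^ 2)) : f s x ≤ f s y := by
  unfold f
  apply Real.exp_le_exp.2
  have a := Real.sqrt_nonneg x
  have b := Real.sqrt_le_sqrt hxy
  have c : Real.sqrt y ≤ 1 / (2 * s) := by
    rw [Real.sqrt_le_left (by positivity)]
    refine hy.trans (le_of_eq ?_)
    field_simp; norm_num
  have c' : Real.sqrt y * (2 * s) ≤ 1 := by rwa [le_div_iff₀ (by positivity)] at c
  have d := Real.mul_self_sqrt hx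
  have e := Real.mul_self_sqrt (hx.trans hxy)
  have : 0 ≤ (Real.sqrt y - Real.sqrt x) * (1 - s * (Real.sqrt y + Real.sqrt x)) := by
    apply mul_nonneg (by linarith)
    nlinarith
  nlinarith

lemma f_anti (s : ℝ) (hs : 0 < s) {x y : ℝ} (hxy : x ≤ y)
    (hy : 1 / (4 * s ^ 2) ≤ x) : f s y ≤ f s x := by
  unfold f
  apply Real.exp_le_exp.2
  have hx : 0 ≤ x := le_trans (by positivity) hy
  have b := Real.sqrt_le_sqrt hxy
  have c : 1 / (2 * s) ≤ Real.sqrt x := by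
    apply Real.le_sqrt_of_sq_le
    refine le_trans (le_of_eq ?_) hy
    field_simp; norm_num
  have c' : 1 ≤ Real.sqrt x * (2 * s) := by rwa [div_le_iff₀ (by positivity)] at c
  have d := Real.mul_self_sqrt hx
  have e := Real.mul_self_sqrt (hx.trans hxy)
  have : 0 ≤ (Real.sqrt y - Real.sqrt x) * (s * (Real.sqrt y + Real.sqrt x) - 1) := by
    apply mul_nonneg (by linarith)
    nlinarith
  nlinarith

lemma f_max (s : ℝ) (hs : 0 < s) : f s (1 / (4 * s ^ 2)) = Real.exp (1 / (4 * s)) := by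
  unfold f
  have : Real.sqrt (1 / (4 * s ^ 2)) = 1 / (2 * s) := by
    rw [show 1 / (4 * s ^ 2) = (1 / (2 * s)) ^ 2 by field_simp; norm_num]
    exact Real.sqrt_sq (by positivity)
  rw [this]
  congr 1
  field_simp
  ring

lemma f_le (s : ℝ) (hs : 0 < s) {x : ℝ} (hx : 0 ≤ x) : f s x ≤ Real.exp (1 / (4 * s)) := by
  rw [← f_max s hs]
  rcases le_total x (1 / (4 * s ^ 2)) with h | h
  · exact f_mono s hs hx h le_rfl
  · exact f_anti s hs h le_rfl

lemma V_spec (s : ℝ) (hs : 0 < s) {x y : ℝ} (hx : 0 ≤ x) (hxy : x ≤ y) :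
    |f s y - f s x| ≤ V s y - V s x := by
  unfold V
  set M := 1 / (4 * s ^ 2) with hM
  rcases le_total y M with h | h
  · have := f_mono s hs hx hxy h
    rw [min_eq_left h, max_eq_right h, min_eq_left (hxy.trans h), max_eq_right (hxy.trans h),
      abs_of_nonneg (by linarith)]
    linarith
  · rcases le_total x M with h' | h'
    · have h1 := f_mono s hs hx h' le_rfl
      have h2 := f_anti s hs h le_rfl
      rw [min_eq_right h, max_eq_left h, min_eq_left h', max_eq_right h', abs_le]
      constructor <;> linarith
    · have := f_anti s hs hxy h'
      rw [min_eq_right h, max_eq_left h, min_eq_right h', max_eq_left h',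
        abs_of_nonpos (by linarith)]
      linarith

lemma V_bound (s : ℝ) (hs : 0 < s) (x : ℝ) (hx : 0 ≤ x) :
    V s x - V s 0 ≤ 2 * Real.exp (1 / (4 * s)) := by
  have hM : (0:ℝ) ≤ 1 / (4 * s ^ 2) := by positivity
  have h1 := f_le s hs (x := min x (1 / (4 * s ^ 2))) (le_min hx hM)
  have h2 : 0 < f s (max x (1 / (4 * s ^ 2))) := Real.exp_pos _
  have h3 : 0 < f s 0 := Real.exp_pos _
  have h4 := f_max s hs
  unfold V
  rw [min_eq_left hM, max_eq_right hM]
  linarith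

lemma step (s : ℝ) (hs : 0 < s) (n : ℕ) :
    |f s (n + 1) - (H s (n + 1) - H s n)| ≤ V s (n + 1) - V s n := by
  have hn : (0:ℝ) ≤ n := Nat.cast_nonneg n
  obtain ⟨ξ, ⟨h1, h2⟩, h3⟩ := exists_hasDerivAt_eq_slope (H s) (f s)
    (show (n:ℝ) < n + 1 by linarith) (H_cont s hs).continuousOn
    (fun x hx => H_deriv s hs x (lt_of_le_of_lt hn hx.1))
  rw [add_sub_cancel_left, div_one] at h3
  rw [← h3]
  have a := V_spec s hs (hn.trans h1.le) h2.le
  have b := (abs_nonneg _).trans (V_spec s hs hn h1.le)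
  linarith

lemma partial_sum (s : ℝ) (hs : 0 < s) (N : ℕ) :
    |∑ n ∈ Finset.range N, f s (n + 1) - (H s N - H s 0)| ≤ 2 * Real.exp (1 / (4 * s)) := by
  have : |∑ n ∈ Finset.range N, f s (n + 1) - (H s N - H s 0)| ≤ V s N - V s 0 := by
    induction N with
    | zero => simp
    | succ k ih =>
      have h := step s hs k
      rw [Finset.sum_range_succ]
      push_cast
      rw [abs_le] at *
      constructor <;> linarith [h.1, h.2, ih.1, ih.2]
  exact this.trans (V_bound s hs N (Nat.cast_nonneg N))

lemma H_tendsto (s : ℝ) (hs : 0 < s) :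
    ∃ K : ℝ, 0 ≤ K ∧ K ≤ 1 ∧ Tendsto (fun N : ℕ => H s N - H s 0) atTop
      (nhds ((1 / s) * (Real.exp (1 / (4 * s)) * Real.sqrt (Real.pi / s) + K))) := by
  obtain ⟨K, h0, h1, hK⟩ := G_tendsto s hs
  refine ⟨1 - K, by linarith, by linarith, ?_⟩
  have h2 : Tendsto (fun N : ℕ => Real.sqrt N) atTop atTop :=
    Real.tendsto_sqrt_atTop.comp tendsto_natCast_atTop_atTop
  have h3 := (((hK.comp h2).sub (f_tendsto s hs)).const_mul (1 / s)).sub_const (H s 0)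
  have h4 : H s 0 = -(1 / s) := by simp [H, G, f]
  have h5 : 1 / s * (Real.exp (1 / (4 * s)) * Real.sqrt (Real.pi / s) + (1 - K)) =
      1 / s * (Real.exp (1 / (4 * s)) * Real.sqrt (Real.pi / s) - K - 0) - H s 0 := by
    rw [h4]; ring
  rw [h5]
  exact h3

lemma main_s (s : ℝ) (hs : 0 < s) :
    |∑' n : ℕ, f s (n + 1) - (1 / s) * (Real.exp (1 / (4 * s)) * Real.sqrt (Real.pi / s))|
      ≤ 6 * Real.exp (1 / (4 * s)) := by
  obtain ⟨K, h0, h1, hK⟩ := H_tendsto s hs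
  obtain ⟨B, hB⟩ := hK.bddAbove_range
  have hsum : Summable fun n : ℕ => f s ((n:ℝ) + 1) := by
    refine summable_of_sum_range_le (c := B + 2 * Real.exp (1 / (4 * s)))
      (fun n => (Real.exp_pos _).le) fun N => ?_
    have a := (abs_le.1 (partial_sum s hs N)).2
    have b := hB ⟨N, rfl⟩
    simp only at b
    linarith
  have hl := (hsum.hasSum.tendsto_sum_nat.sub hK).abs
  have hle := le_of_tendsto hl (Eventually.of_forall fun N => partial_sum s hs N)
  have hs1 : 1 / s ≤ 4 * Real.exp (1 / (4 * s)) := by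
    have := Real.add_one_le_exp (1 / (4 * s))
    have e : 1 / s = 4 * (1 / (4 * s)) := by field_simp
    linarith
  have hk1 : (1 / s) * K ≤ 1 / s := by
    have : 0 < 1 / s := by positivity
    nlinarith
  have hk0 : 0 ≤ (1 / s) * K := by positivity
  rw [abs_le] at *
  constructor <;> linarith [hle.1, hle.2]

lemma log_est (d : ℝ) (h0 : 0 < d) (h1 : d < 1 / 4) :
    ∃ s : ℝ, s = -Real.log (1 - d) ∧ d ≤ s ∧ s ≤ 2 * d ∧ 1 - 2 * d ≤ d / s ∧
      |1 / (4 * s) - 1 / (4 * d) + 1 / 8| ≤ d := by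
  refine ⟨_, rfl, ?_⟩
  have hds : d ≤ -Real.log (1 - d) := by
    have := Real.log_le_sub_one_of_pos (show 0 < 1 - d by linarith)
    linarith
  have h := Real.abs_log_sub_add_sum_range_le (x := d) (by rw [abs_of_pos h0]; linarith) 2
  rw [abs_of_pos h0] at h
  simp only [Finset.sum_range_succ, Finset.sum_range_zero] at h
  norm_num at h
  have hl : Real.log (1 - d) = -(-Real.log (1 - d)) := by ring
  rw [hl] at h
  generalize -Real.log (1 - d) = s at *
  have hb : d ^ 3 / (1 - d) ≤ 2 * d ^ 3 := by
    rw [div_le_iff₀ (by linarith)]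
    nlinarith [pow_pos h0 3]
  have h' := abs_le.1 (h.trans hb)
  obtain ⟨ha, hc⟩ := h'
  have hs0 : 0 < s := by linarith
  have hd2 : 0 < d ^ 2 := by positivity
  have hd3 : 0 < d ^ 3 := by positivity
  have hd32 : d ^ 3 ≤ d ^ 2 / 4 := by nlinarith
  have hd21 : d ^ 2 ≤ d / 4 := by nlinarith
  refine ⟨hds, by linarith, ?_, ?_⟩
  · rw [le_div_iff₀ hs0]
    nlinarith
  · have e : 1 / (4 * s) - 1 / (4 * d) + 1 / 8 = (2 * d - 2 * s + s * d) / (8 * (s * d)) := by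
      field_simp
      ring
    have hsd : d ^ 2 ≤ s * d := by nlinarith
    have hsd3 : d ^ 3 ≤ s * d * d := by nlinarith
    rw [e, abs_div, abs_of_pos (show 0 < 8 * (s * d) by positivity),
      div_le_iff₀ (by positivity), abs_le]
    constructor <;> nlinarith

lemma final_est (d S : ℝ) (h0 : 0 < d) (h1 : d < 1 / 4)
    (hS : |S - (1 / -Real.log (1 - d)) * (Real.exp (1 / (4 * -Real.log (1 - d))) *
      Real.sqrt (Real.pi / -Real.log (1 - d)))| ≤ 6 * Real.exp (1 / (4 * -Real.log (1 - d)))) :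
    |S / (Real.sqrt Real.pi * Real.exp (-1 / 8) * d ^ (-(3 : ℝ) / 2) *
            Real.exp (1 / (4 * d))) - 1| ≤ 29 * d := by
  obtain ⟨s, hs, hds, hs2, hq, ht⟩ := log_est d h0 h1
  rw [← hs] at hS
  have hs0 : 0 < s := by linarith
  set t := 1 / (4 * s) - 1 / (4 * d) + 1 / 8 with htdef
  set D := Real.sqrt Real.pi * Real.exp (-1 / 8) * d ^ (-(3 : ℝ) / 2) * Real.exp (1 / (4 * d))
    with hD
  have hD0 : 0 < D := by positivity
  set A := (1 / s) * (Real.exp (1 / (4 * s)) * Real.sqrt (Real.pi / s)) with hA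
  have hpi : 1 ≤ Real.sqrt Real.pi := by
    rw [Real.one_le_sqrt]; linarith [Real.pi_gt_three]
  have hsq : s * Real.sqrt s = s ^ ((3:ℝ) / 2) := by
    rw [Real.sqrt_eq_rpow, ← Real.rpow_one_add' hs0.le (by norm_num)]; norm_num
  have hexp : Real.exp (1 / (4 * s)) =
      Real.exp t * (Real.exp (-1 / 8) * Real.exp (1 / (4 * d))) := by
    rw [← Real.exp_add, ← Real.exp_add]; congr 1; rw [htdef]; ring
  have hdn : d ^ (-(3:ℝ) / 2) = (d ^ ((3:ℝ) / 2))⁻¹ := by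
    rw [← Real.rpow_neg h0.le]; norm_num
  have hdp : 0 < d ^ ((3:ℝ) / 2) := by positivity
  have hsp : 0 < s ^ ((3:ℝ) / 2) := by positivity
  have hpi0 : 0 < Real.sqrt Real.pi := by positivity
  have hAD : A / D = (d / s) ^ ((3:ℝ) / 2) * Real.exp t := by
    rw [Real.div_rpow h0.le hs0.le, hA, hD, hexp, hdn, Real.sqrt_div' _ hs0.le, ← hsq]
    have := Real.sqrt_pos.2 hs0
    field_simp
  have hED : Real.exp (1 / (4 * s)) / D = Real.exp t * d ^ ((3:ℝ) / 2) / Real.sqrt Real.pi := by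
    rw [hD, hexp, hdn]
    field_simp
  have ht' := abs_le.1 ht
  have het : Real.exp t ≤ 1 + 2 * d := by
    have a : Real.exp t ≤ Real.exp d := Real.exp_le_exp.2 ht'.2
    have b := Real.abs_exp_sub_one_sub_id_le (x := d) (by rw [abs_of_pos h0]; linarith)
    have b' := (abs_le.1 b).2
    nlinarith
  have het' : 1 - d ≤ Real.exp t := by linarith [Real.add_one_le_exp t]
  have hq1 : d / s ≤ 1 := by rw [div_le_one hs0]; exact hds
  have hq0 : 0 < d / s := by positivity
  have hp1 : (d / s) ^ ((3:ℝ) / 2) ≤ 1 := Real.rpow_le_one hq0.le hq1 (by norm_num)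
  have hp2 : 1 - 4 * d ≤ (d / s) ^ ((3:ℝ) / 2) := by
    have : (d / s) ^ (2:ℝ) ≤ (d / s) ^ ((3:ℝ) / 2) :=
      Real.rpow_le_rpow_of_exponent_ge hq0 hq1 (by norm_num)
    rw [Real.rpow_two] at this
    nlinarith
  have hd3 : d ^ ((3:ℝ) / 2) ≤ d := by
    have : d ^ ((3:ℝ) / 2) ≤ d ^ (1:ℝ) :=
      Real.rpow_le_rpow_of_exponent_ge h0 (by linarith) (by norm_num)
    rwa [Real.rpow_one] at this
  have e1 : |A / D - 1| ≤ 5 * d := by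
    rw [hAD, abs_le]
    have hep := Real.exp_pos t
    constructor
    · nlinarith
    · nlinarith
  have e2 : |(S - A) / D| ≤ 12 * d := by
    rw [abs_div, abs_of_pos hD0]
    calc |S - A| / D ≤ 6 * Real.exp (1 / (4 * s)) / D := by gcongr
      _ = 6 * (Real.exp t * d ^ ((3:ℝ) / 2) / Real.sqrt Real.pi) := by
        rw [mul_div_assoc, hED]
      _ ≤ 6 * (Real.exp t * d ^ ((3:ℝ) / 2)) := by
        gcongr
        exact div_le_self (by positivity) hpi
      _ ≤ 6 * (2 * d) := by
        gcongr
        linarith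
      _ = 12 * d := by ring
  have e3 : S / D - 1 = (S - A) / D + (A / D - 1) := by ring
  rw [e3]
  exact (abs_add_le _ _).trans (by linarith)

end ExpSqrtAux

/-- For every `ε > 0`, as `z → −1⁺` with `z ∈ (−1, 0)` real,
`∑_{n≥1} e^{√n}(−z)^n = √π e^{−1/8} (1+z)^{−3/2} exp(1/(4(1+z))) (1 + O((1+z)^{1/2−ε}))`. -/
theorem exp_sqrt_genfun_at_minus_one (ε : ℝ) (hε : 0 < ε) :
    (fun z : ℝ =>
        (∑' n : ℕ, Real.exp (Real.sqrt ((n : ℝ) + 1)) * (-z) ^ (n + 1)) /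
          (Real.sqrt Real.pi * Real.exp (-1 / 8) * (1 + z) ^ (-(3 : ℝ) / 2) *
            Real.exp (1 / (4 * (1 + z)))) - 1)
      =O[nhdsWithin (-1 : ℝ) (Set.Ioo (-1) 0)]
        fun z : ℝ => (1 + z) ^ ((1 : ℝ) / 2 - ε) := by
  refine IsBigO.of_bound 29 ?_
  have hev : ∀ᶠ z : ℝ in nhdsWithin (-1 : ℝ) (Set.Ioo (-1) 0), z < -3 / 4 :=
    mem_nhdsWithin_of_mem_nhds (Iio_mem_nhds (by norm_num))
  filter_upwards [hev, self_mem_nhdsWithin] with z hz hz'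
  have h0 : 0 < 1 + z := by linarith [hz'.1]
  have hs : 0 < -Real.log (1 - (1 + z)) := by
    have := Real.log_neg (show 0 < 1 - (1 + z) by linarith) (by linarith)
    linarith
  have hm := ExpSqrtAux.main_s _ hs
  have heq : ∀ n : ℕ, Real.exp (Real.sqrt ((n : ℝ) + 1)) * (-z) ^ (n + 1) =
      ExpSqrtAux.f (-Real.log (1 - (1 + z))) (n + 1) := by
    intro n
    have hz0 : 0 < -z := by linarith
    rw [ExpSqrtAux.f, show 1 - (1 + z) = -z by ring, sub_eq_add_neg, Real.exp_add]
    congr 1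
    rw [← Real.rpow_natCast, Real.rpow_def_of_pos hz0]
    congr 1
    push_cast
    ring
  simp_rw [heq]
  have hf := ExpSqrtAux.final_est (1 + z) _ h0 (by linarith) hm
  rw [Real.norm_eq_abs, Real.norm_eq_abs, abs_of_pos (Real.rpow_pos_of_pos h0 _)]
  refine hf.trans ?_
  gcongr
  have : (1 + z) ^ (1:ℝ) ≤ (1 + z) ^ ((1 : ℝ) / 2 - ε) :=
    Real.rpow_le_rpow_of_exponent_ge h0 (by linarith) (by linarith)
  rwa [Real.rpow_one] at this
end
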